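/- arXiv:1111.0111 — 5 statements merged into one kernel-verified Lean document; each statement's English description precedes it below -/
import Mathlib

section
/- There exist two flows φ and φ̂ on the 2-sphere S² = {x ∈ ℝ³ : ‖x‖ = 1} (with its standard smooth manifold structure), each of class C^∞, such that φ and φ̂ are equivalent, EP(φ) = 0, and EP(φ̂) = ∞. -/
open Set Filter Topology Manifold

/-- A (continuous) flow on a topological space. -/
def IsFlow {M : Type*} [TopologicalSpace M] (φ : ℝ → M → M) : Prop :=
  Continuous (fun p : ℝ × M => φ p.1 p.2) ∧ (∀ x, φ 0 x = x) ∧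
    ∀ s t : ℝ, ∀ x, φ (s + t) x = φ s (φ t x)

/-- The orbit of a point under a flow. -/
def flowOrbit {M : Type*} (φ : ℝ → M → M) (x : M) : Set M := {y | ∃ t : ℝ, φ t x = y}

/-- A periodic point of the flow (fixed points included). -/
def IsFlowPeriodicPt {M : Type*} (φ : ℝ → M → M) (x : M) : Prop := ∃ s : ℝ, 0 < s ∧ φ s x = x

/-- `P_t(φ)`: the set of isolated periodic orbits of period at most `t`. -/
def periodicOrbits {M : Type*} [TopologicalSpace M] (φ : ℝ → M → M) (t : ℝ) : Set (Set M) :=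
  {o | ∃ x : M, o = flowOrbit φ x ∧ (∃ s : ℝ, 0 < s ∧ s ≤ t ∧ φ s x = x) ∧
    ∃ U : Set M, IsOpen U ∧ flowOrbit φ x ⊆ U ∧
      ∀ y ∈ U, IsFlowPeriodicPt φ y → y ∈ flowOrbit φ x}

/-- Logarithm of an extended natural cardinality, valued in `[0,∞]`. -/
noncomputable def elog (n : ℕ∞) : ENNReal :=
  if n = ⊤ then ⊤ else ENNReal.ofReal (Real.log n.toNat)

/-- The exponential growth rate of periodic orbits of a flow. -/
noncomputable def EP {M : Type*} [TopologicalSpace M] (φ : ℝ → M → M) : ENNReal :=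
  Filter.limsup (fun t : ℝ => ENNReal.ofReal (1 / t) * elog (periodicOrbits φ t).encard)
    Filter.atTop

/-- Equivalence of flows: a homeomorphism sending orbits onto orbits preserving
time orientation. -/
def FlowEquiv {M : Type*} [TopologicalSpace M] (φ ψ : ℝ → M → M) : Prop :=
  ∃ h : M ≃ₜ M, ∀ x : M,
    h '' flowOrbit φ x = flowOrbit ψ (h x) ∧
    h '' {y | ∃ t : ℝ, 0 ≤ t ∧ φ t x = y} = {y | ∃ s : ℝ, 0 ≤ s ∧ ψ s (h x) = y}

open scoped ContDiff

/-- Differentiation under the integral sign, `C^n` version over the unit interval. -/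
theorem contDiff_integral_unitInterval (n : ℕ) {E F : Type} [NormedAddCommGroup E]
    [NormedSpace ℝ E] [ProperSpace E] [NormedAddCommGroup F] [NormedSpace ℝ F] [CompleteSpace F]
    {f : E × ℝ → F} (hf : ContDiff ℝ n f) :
    ContDiff ℝ n (fun x => ∫ u in (0 : ℝ)..1, f (x, u)) := by
  induction n generalizing F with
  | zero =>
    simp only [CharP.cast_eq_zero, contDiff_zero] at hf ⊢
    exact intervalIntegral.continuous_parametric_intervalIntegral_of_continuous'
      (f := fun x u => f (x, u)) hf 0 1
  | succ n ih =>
    have hf1 : ContDiff ℝ ((n : ℕ∞ω) + 1) f := by exact_mod_cast hf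
    have hd : ContDiff ℝ n (fun p : E × ℝ =>
        (fderiv ℝ f p).comp (ContinuousLinearMap.inl ℝ E ℝ)) :=
      (hf1.fderiv_right le_rfl).clm_comp contDiff_const
    have key : ContDiff ℝ ((n : ℕ∞ω) + 1) (fun x => ∫ u in (0 : ℝ)..1, f (x, u)) := by
      rw [contDiff_succ_iff_hasFDerivAt]
      refine ⟨fun x : E => ∫ u in (0 : ℝ)..1,
        (fderiv ℝ f (x, u)).comp (ContinuousLinearMap.inl ℝ E ℝ), ih hd, fun x => ?_⟩
      obtain ⟨C, hC⟩ := ((isCompact_closedBall x 1).prod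
        (isCompact_Icc (a := (0 : ℝ)) (b := 1))).exists_bound_of_continuousOn
        hd.continuous.continuousOn
      refine intervalIntegral.hasFDerivAt_integral_of_dominated_of_fderiv_le
        (𝕜 := ℝ) (F := fun (x : E) (u : ℝ) => f (x, u))
        (F' := fun x u => (fderiv ℝ f (x, u)).comp (ContinuousLinearMap.inl ℝ E ℝ))
        (bound := fun _ => C)
        (Metric.closedBall_mem_nhds x one_pos) ?_ ?_ ?_ ?_ ?_ ?_
      · exact Eventually.of_forall fun y =>
          (hf.continuous.comp (by fun_prop)).aestronglyMeasurable
      · exact (hf.continuous.comp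
          (by fun_prop : Continuous fun u : ℝ => (x, u))).intervalIntegrable _ _
      · exact (hd.continuous.comp
          (by fun_prop : Continuous fun u : ℝ => (x, u))).aestronglyMeasurable
      · refine Eventually.of_forall fun u hu y hy => hC (y, u) ⟨hy, ?_⟩
        rw [uIoc_of_le zero_le_one] at hu
        exact Ioc_subset_Icc_self hu
      · exact intervalIntegrable_const
      · refine Eventually.of_forall fun u _ y _ => ?_
        have h1 := (hf1.differentiable (by simp) (y, u)).hasFDerivAt
        exact h1.comp y (hasFDerivAt_prodMk_left y u)
    exact_mod_cast key

/-- The integral of `F (s, z)` over `s ∈ [0, t]` is `C^n` in `(t, z)`. -/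
theorem contDiff_integral_zero_to (n : ℕ) {F : ℝ × ℝ → ℝ} (hF : ContDiff ℝ n F) :
    ContDiff ℝ n (fun p : ℝ × ℝ => ∫ s in (0 : ℝ)..p.1, F (s, p.2)) := by
  have h : (fun p : ℝ × ℝ => ∫ s in (0 : ℝ)..p.1, F (s, p.2)) =
      fun p => p.1 * ∫ u in (0 : ℝ)..1, F (p.1 * u, p.2) := by
    ext p
    have := intervalIntegral.smul_integral_comp_mul_left (a := 0) (b := 1)
      (fun s => F (s, p.2)) p.1
    simpa using this.symm
  rw [h]
  refine contDiff_fst.mul (contDiff_integral_unitInterval n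
    (f := fun q : (ℝ × ℝ) × ℝ => F (q.1.1 * q.2, q.1.2)) (hF.comp (by fun_prop)))

/-- A solution of a scalar linear equation is given by the integrating factor. -/
theorem eq_mul_exp_of_hasDerivAt_mul {D k : ℝ → ℝ} (hk : Continuous k)
    (hD : ∀ t, HasDerivAt D (k t * D t) t) (t : ℝ) :
    D t = D 0 * Real.exp (∫ s in (0 : ℝ)..t, k s) := by
  have hI : ∀ t, HasDerivAt (fun t => ∫ s in (0 : ℝ)..t, k s) (k t) t := fun t =>
    (hk.integral_hasStrictDerivAt 0 t).hasDerivAt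
  have hc : ∀ t, HasDerivAt (fun t => D t * Real.exp (-∫ s in (0 : ℝ)..t, k s)) 0 t := by
    intro t
    refine ((hD t).mul (hI t).neg.exp).congr_deriv ?_
    simp only [Pi.neg_apply]
    ring
  have := is_const_of_deriv_eq_zero (fun t => (hc t).differentiableAt)
    (fun t => (hc t).deriv) t 0
  simp only [intervalIntegral.integral_same, neg_zero, Real.exp_zero, mul_one] at this
  rw [← this, mul_assoc, ← Real.exp_add]
  simp

/-- The divided difference of a `C^1` function, as an average of its derivative. -/
noncomputable def dividedDiff (a : ℝ → ℝ) (p : ℝ × ℝ) : ℝ :=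
  ∫ u in (0 : ℝ)..1, deriv a (p.2 + u * (p.1 - p.2))

theorem continuous_dividedDiff {a : ℝ → ℝ} (ha : Continuous (deriv a)) :
    Continuous (dividedDiff a) :=
  intervalIntegral.continuous_parametric_intervalIntegral_of_continuous'
    (f := fun (p : ℝ × ℝ) u => deriv a (p.2 + u * (p.1 - p.2)))
    (by simp only [Function.uncurry_def]; fun_prop) 0 1

theorem dividedDiff_self (a : ℝ → ℝ) (x : ℝ) : dividedDiff a (x, x) = deriv a x := by
  simp [dividedDiff]

theorem dividedDiff_mul_sub {a : ℝ → ℝ} (ha : Differentiable ℝ a) (ha' : Continuous (deriv a))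
    (x y : ℝ) : dividedDiff a (x, y) * (x - y) = a x - a y := by
  have h : ∀ u ∈ uIcc (0 : ℝ) 1, HasDerivAt (fun u => a (y + u * (x - y)))
      (deriv a (y + u * (x - y)) * (x - y)) u := by
    intro u _
    have h2 : HasDerivAt (fun u : ℝ => y + u * (x - y)) (x - y) u := by
      simpa using ((hasDerivAt_id u).mul_const (x - y)).const_add y
    exact (ha _).hasDerivAt.comp u h2
  have := intervalIntegral.integral_eq_sub_of_hasDerivAt h
    (Continuous.intervalIntegrable (by fun_prop) _ _)
  rw [intervalIntegral.integral_mul_const] at this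
  simpa [dividedDiff] using this

theorem exists_integralCurve {a : ℝ → ℝ} (ha : ContDiff ℝ 1 a) (hc : HasCompactSupport a)
    (x : ℝ) : ∃ γ : ℝ → ℝ, γ 0 = x ∧ ∀ t, HasDerivAt γ (a (γ t)) t := by
  obtain ⟨C', hC'⟩ := hc.deriv.exists_bound_of_continuous (ha.continuous_deriv le_rfl)
  have hK : LipschitzWith C'.toNNReal a :=
    lipschitzWith_of_nnnorm_deriv_le (ha.differentiable one_ne_zero) fun y =>
      (hC' y).trans (Real.le_coe_toNNReal C')
  obtain ⟨C, hC⟩ := hc.exists_bound_of_continuous ha.continuous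
  have hv : CMDiff 1 (fun x : ℝ => (⟨x, a x⟩ : TangentBundle 𝓘(ℝ, ℝ) ℝ)) := by
    exact contMDiff_vectorSpace_iff_contDiff.2 ha
  obtain ⟨γ, h0, hγ⟩ := (exists_isMIntegralCurve_iff_exists_isMIntegralCurveOn_Ioo
    (I := 𝓘(ℝ, ℝ)) (v := a) hv x).2 (by
      intro T
      by_cases hT : 0 < T
      swap
      · exact ⟨fun _ => x, rfl, fun t ht => by exfalso; linarith [ht.1, ht.2]⟩
      have hpl : IsPicardLindelof (fun _ => a) (tmin := -T) (tmax := T)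
          ⟨0, by constructor <;> linarith⟩ x (C.toNNReal * T.toNNReal) 0 C.toNNReal
          C'.toNNReal := by
        refine ⟨fun _ _ => hK.lipschitzOnWith, fun _ _ => continuousOn_const, ?_, ?_⟩
        · intro t _ y _
          exact (hC y).trans (Real.le_coe_toNNReal C)
        · simp [hT.le]
      obtain ⟨α, h0, hα⟩ := hpl.exists_eq_forall_mem_Icc_hasDerivWithinAt₀
      refine ⟨α, h0, fun t ht => ?_⟩
      have := (hα t (Ioo_subset_Icc_self ht)).hasDerivAt (Icc_mem_nhds ht.1 ht.2)
      exact this.hasFDerivAt.hasMFDerivAt.hasMFDerivWithinAt)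
  refine ⟨γ, h0, fun t => ?_⟩
  have h : HasFDerivAt γ ((1 : ℝ →L[ℝ] ℝ).smulRight (a (γ t))) t :=
    hasMFDerivAt_iff_hasFDerivAt.1 (hγ t)
  simpa using h.hasDerivAt

/-- `Z` is the (global) flow of the autonomous scalar equation `z' = a z`. -/
structure IsScalarFlow (a : ℝ → ℝ) (Z : ℝ → ℝ → ℝ) : Prop where
  zero_apply : ∀ z, Z 0 z = z
  hasDerivAt : ∀ z t, HasDerivAt (fun t => Z t z) (a (Z t z)) t

theorem exists_isScalarFlow {a : ℝ → ℝ} (ha : ContDiff ℝ 1 a) (hc : HasCompactSupport a) :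
    ∃ Z, IsScalarFlow a Z := by
  choose γ h0 hγ using exists_integralCurve ha hc
  exact ⟨fun t z => γ z t, h0, hγ⟩

theorem sub_eq_mul_exp_of_hasDerivAt {a k y₁ y₂ : ℝ → ℝ} (ha : ContDiff ℝ 1 a) (hk : Continuous k)
    (h₁ : ∀ t, HasDerivAt y₁ (k t * a (y₁ t)) t) (h₂ : ∀ t, HasDerivAt y₂ (k t * a (y₂ t)) t)
    (t : ℝ) : y₁ t - y₂ t =
      (y₁ 0 - y₂ 0) * Real.exp (∫ s in (0 : ℝ)..t, k s * dividedDiff a (y₁ s, y₂ s)) := by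
  have ha' := ha.continuous_deriv le_rfl
  have c₁ : Continuous y₁ := continuous_iff_continuousAt.2 fun t => (h₁ t).continuousAt
  have c₂ : Continuous y₂ := continuous_iff_continuousAt.2 fun t => (h₂ t).continuousAt
  refine eq_mul_exp_of_hasDerivAt_mul (D := fun t => y₁ t - y₂ t)
    (hk.mul ((continuous_dividedDiff ha').comp (c₁.prodMk c₂))) (fun t => ?_) t
  refine ((h₁ t).sub (h₂ t)).congr_deriv ?_
  change _ = k t * dividedDiff a (y₁ t, y₂ t) * (y₁ t - y₂ t)
  rw [mul_assoc, dividedDiff_mul_sub (ha.differentiable one_ne_zero) ha']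
  ring

theorem eq_of_hasDerivAt {a k y₁ y₂ : ℝ → ℝ} (ha : ContDiff ℝ 1 a) (hk : Continuous k)
    (h₁ : ∀ t, HasDerivAt y₁ (k t * a (y₁ t)) t) (h₂ : ∀ t, HasDerivAt y₂ (k t * a (y₂ t)) t)
    (h0 : y₁ 0 = y₂ 0) (t : ℝ) : y₁ t = y₂ t := by
  have := sub_eq_mul_exp_of_hasDerivAt ha hk h₁ h₂ t
  rw [h0, sub_self, zero_mul] at this
  exact sub_eq_zero.1 this

namespace IsScalarFlow

variable {a : ℝ → ℝ} {Z : ℝ → ℝ → ℝ}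

theorem hasDerivAt_one_mul (hZ : IsScalarFlow a Z) (z t : ℝ) :
    HasDerivAt (fun t => Z t z) (1 * a (Z t z)) t := by
  simpa using hZ.hasDerivAt z t

theorem continuous_time (hZ : IsScalarFlow a Z) (z : ℝ) : Continuous fun t => Z t z :=
  continuous_iff_continuousAt.2 fun t => (hZ.hasDerivAt z t).continuousAt

theorem sub_eq (hZ : IsScalarFlow a Z) (ha : ContDiff ℝ 1 a) (t x y : ℝ) :
    Z t x - Z t y = (x - y) * Real.exp (∫ s in (0 : ℝ)..t, dividedDiff a (Z s x, Z s y)) := by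
  simpa [hZ.zero_apply] using sub_eq_mul_exp_of_hasDerivAt ha (k := fun _ => 1) continuous_const
    (hZ.hasDerivAt_one_mul x) (hZ.hasDerivAt_one_mul y) t

theorem add_apply (hZ : IsScalarFlow a Z) (ha : ContDiff ℝ 1 a) (s t z : ℝ) :
    Z (s + t) z = Z s (Z t z) := by
  refine eq_of_hasDerivAt (y₁ := fun s => Z (s + t) z) ha (k := fun _ => 1) continuous_const
    (fun s => ?_) (hZ.hasDerivAt_one_mul (Z t z)) ?_ s
  · exact (hZ.hasDerivAt_one_mul z (s + t)).comp_add_const s t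
  · simp [hZ.zero_apply]

theorem apply_of_eq_zero (hZ : IsScalarFlow a Z) (ha : ContDiff ℝ 1 a) {z : ℝ} (hz : a z = 0)
    (t : ℝ) : Z t z = z :=
  eq_of_hasDerivAt (y₂ := fun _ => z) ha (k := fun _ => 1) continuous_const
    (hZ.hasDerivAt_one_mul z) (fun t => by simpa [hz] using hasDerivAt_const t z)
    (hZ.zero_apply z) t

theorem eq_zero_of_apply_eq (hZ : IsScalarFlow a Z) (ha : ∀ x, 0 ≤ a x) {z s : ℝ} (hs : 0 < s)
    (hz : Z s z = z) : a z = 0 := by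
  have hmono : Monotone fun t => Z t z :=
    monotone_of_hasDerivAt_nonneg (hZ.hasDerivAt z) fun t => ha _
  have hconst : ∀ t ∈ Icc 0 s, Z t z = z := fun t ht => le_antisymm
    ((hmono ht.2).trans_eq hz) ((hZ.zero_apply z).symm.trans_le (hmono ht.1))
  have h1 : HasDerivWithinAt (fun t => Z t z) 0 (Icc 0 s) 0 :=
    (hasDerivWithinAt_const _ _ z).congr hconst (hconst 0 ⟨le_rfl, hs.le⟩)
  have h2 := (hZ.hasDerivAt z 0).hasDerivWithinAt (s := Icc 0 s)
  rw [hZ.zero_apply] at h2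
  exact (uniqueDiffOn_Icc hs 0 ⟨le_rfl, hs.le⟩).eq_deriv _ h2 h1

theorem continuous (hZ : IsScalarFlow a Z) (ha : ContDiff ℝ 1 a) (hc : HasCompactSupport a) :
    Continuous fun p : ℝ × ℝ => Z p.1 p.2 := by
  obtain ⟨C, hC⟩ := hc.deriv.exists_bound_of_continuous (ha.continuous_deriv le_rfl)
  have hq : ∀ p, ‖dividedDiff a p‖ ≤ C := fun p => by
    simpa [dividedDiff] using intervalIntegral.norm_integral_le_of_norm_le_const (a := 0) (b := 1)
      (f := fun u => deriv a (p.2 + u * (p.1 - p.2))) fun u _ => hC _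
  have hlip : ∀ t x y, |Z t x - Z t y| ≤ |x - y| * Real.exp (C * |t|) := by
    intro t x y
    rw [hZ.sub_eq ha, abs_mul, Real.abs_exp]
    gcongr
    simpa using (le_abs_self _).trans (intervalIntegral.norm_integral_le_of_norm_le_const
      (a := 0) (b := t) (f := fun s => dividedDiff a (Z s x, Z s y)) fun u _ => hq _)
  refine continuous_iff_continuousAt.2 fun p => ?_
  rw [ContinuousAt, tendsto_iff_dist_tendsto_zero]
  have hct := hZ.continuous_time p.2
  have hlim : Tendsto (fun r : ℝ × ℝ => |r.2 - p.2| * Real.exp (C * |r.1|)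
      + |Z r.1 p.2 - Z p.1 p.2|) (𝓝 p) (𝓝 0) := by
    have : Continuous fun r : ℝ × ℝ => |r.2 - p.2| * Real.exp (C * |r.1|)
      + |Z r.1 p.2 - Z p.1 p.2| := by fun_prop
    simpa using this.tendsto p
  refine squeeze_zero (fun _ => dist_nonneg) (fun r => ?_) hlim
  calc dist (Z r.1 r.2) (Z p.1 p.2) ≤ |Z r.1 r.2 - Z r.1 p.2| + |Z r.1 p.2 - Z p.1 p.2| :=
        dist_triangle _ (Z r.1 p.2) _
    _ ≤ _ := by gcongr; exact hlip _ _ _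

theorem hasDerivAt_space (hZ : IsScalarFlow a Z) (ha : ContDiff ℝ 1 a) (hc : HasCompactSupport a)
    (t z : ℝ) : HasDerivAt (Z t) (Real.exp (∫ s in (0 : ℝ)..t, deriv a (Z s z))) z := by
  have hZc := hZ.continuous ha hc
  have hqc := continuous_dividedDiff (ha.continuous_deriv le_rfl)
  have hcont : Continuous fun y =>
      Real.exp (∫ s in (0 : ℝ)..t, dividedDiff a (Z s y, Z s z)) := by
    refine Real.continuous_exp.comp ?_
    refine intervalIntegral.continuous_parametric_intervalIntegral_of_continuous'
      (f := fun y s => dividedDiff a (Z s y, Z s z)) ?_ 0 t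
    refine hqc.comp (Continuous.prodMk ?_ ?_)
    · exact hZc.comp (continuous_snd.prodMk continuous_fst)
    · exact (hZ.continuous_time z).comp continuous_snd
  rw [hasDerivAt_iff_tendsto_slope]
  have h1 := (hcont.tendsto z).mono_left (nhdsWithin_le_nhds (s := {z}ᶜ))
  simp only [dividedDiff_self] at h1
  refine h1.congr' ?_
  filter_upwards [self_mem_nhdsWithin] with y hy
  have hy' : y - z ≠ 0 := sub_ne_zero.2 hy
  rw [slope_def_field, hZ.sub_eq ha]
  field_simp

theorem contDiff_nat (hZ : IsScalarFlow a Z) (ha : ContDiff ℝ ∞ a) (hc : HasCompactSupport a)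
    (n : ℕ) : ContDiff ℝ n fun p : ℝ × ℝ => Z p.1 p.2 := by
  have ha1 : ContDiff ℝ 1 a := ha.of_le (by exact_mod_cast le_top)
  have ha' : ContDiff ℝ ∞ (deriv a) := by
    exact ((contDiff_infty_iff_deriv (f := a)).1 ha).2
  have hZc := hZ.continuous ha1 hc
  induction n with
  | zero => simpa using hZc
  | succ n ih =>
    have hn : (n : ℕ∞ω) ≤ ∞ := by exact_mod_cast le_top
    have hJ : ContDiff ℝ n fun p : ℝ × ℝ =>
        Real.exp (∫ s in (0 : ℝ)..p.1, deriv a (Z s p.2)) :=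
      (contDiff_integral_zero_to n ((ha'.of_le hn).comp ih)).exp
    have hT : ContDiff ℝ n fun p : ℝ × ℝ => a (Z p.1 p.2) := (ha.of_le hn).comp ih
    have key : ContDiff ℝ ((n : ℕ∞ω) + 1) fun p : ℝ × ℝ => Z p.1 p.2 := by
      rw [contDiff_succ_iff_hasFDerivAt]
      let f₁ : ℝ → ℝ → ℝ →L[ℝ] ℝ := fun t z => ContinuousLinearMap.toSpanSingleton ℝ (a (Z t z))
      let f₂ : ℝ → ℝ → ℝ →L[ℝ] ℝ := fun t z => ContinuousLinearMap.toSpanSingleton ℝ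
        (Real.exp (∫ s in (0 : ℝ)..t, deriv a (Z s z)))
      have c₁ : ContDiff ℝ n (fun p : ℝ × ℝ => f₁ p.1 p.2) :=
        (ContinuousLinearMap.toSpanSingletonCLE (𝕜 := ℝ) (E := ℝ)).contDiff.comp hT
      have c₂ : ContDiff ℝ n (fun p : ℝ × ℝ => f₂ p.1 p.2) :=
        (ContinuousLinearMap.toSpanSingletonCLE (𝕜 := ℝ) (E := ℝ)).contDiff.comp hJ
      refine ⟨fun p => (f₁ p.1 p.2).coprod (f₂ p.1 p.2), ?_, fun p => ?_⟩
      · convert (c₁.clm_comp (contDiff_const (c := ContinuousLinearMap.fst ℝ ℝ ℝ))).add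
          (c₂.clm_comp (contDiff_const (c := ContinuousLinearMap.snd ℝ ℝ ℝ))) using 2 with p
        ext <;> simp
      · exact (hasStrictFDerivAt_uncurry_coprod (f := Z) (f₁ := f₁) (f₂ := f₂)
          (Eventually.of_forall fun v => (hZ.hasDerivAt v.2 v.1).hasFDerivAt)
          (Eventually.of_forall fun v => (hZ.hasDerivAt_space ha1 hc v.1 v.2).hasFDerivAt)
          c₁.continuous.continuousAt c₂.continuous.continuousAt).hasFDerivAt
    exact_mod_cast key

theorem contDiff (hZ : IsScalarFlow a Z) (ha : ContDiff ℝ ∞ a) (hc : HasCompactSupport a) :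
    ContDiff ℝ ∞ fun p : ℝ × ℝ => Z p.1 p.2 :=
  contDiff_infty.2 (hZ.contDiff_nat ha hc)

end IsScalarFlow

/-- The integral of the observable `h` along the trajectories of `Z`. -/
noncomputable def timeIntegral (Z : ℝ → ℝ → ℝ) (h : ℝ → ℝ) (t z : ℝ) : ℝ :=
  ∫ s in (0 : ℝ)..t, h (Z s z)

@[simp] theorem timeIntegral_zero (Z : ℝ → ℝ → ℝ) (h : ℝ → ℝ) (z : ℝ) :
    timeIntegral Z h 0 z = 0 := by simp [timeIntegral]

namespace IsScalarFlow

variable {a : ℝ → ℝ} {Z : ℝ → ℝ → ℝ}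

theorem hasDerivAt_timeIntegral (hZ : IsScalarFlow a Z) {h : ℝ → ℝ} (hh : Continuous h)
    (z t : ℝ) : HasDerivAt (fun t => timeIntegral Z h t z) (h (Z t z)) t := by
  have hc : Continuous fun s => h (Z s z) := hh.comp (hZ.continuous_time z)
  exact (hc.integral_hasStrictDerivAt 0 t).hasDerivAt

theorem timeIntegral_add (hZ : IsScalarFlow a Z) (ha : ContDiff ℝ 1 a) {h : ℝ → ℝ}
    (hh : Continuous h) (s t z : ℝ) :
    timeIntegral Z h (s + t) z = timeIntegral Z h t z + timeIntegral Z h s (Z t z) := by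
  have hd : ∀ s, HasDerivAt (fun s => timeIntegral Z h (s + t) z - timeIntegral Z h s (Z t z))
      0 s := fun s => by
    refine (((hZ.hasDerivAt_timeIntegral hh z (s + t)).comp_add_const s t).sub
      (hZ.hasDerivAt_timeIntegral hh (Z t z) s)).congr_deriv ?_
    rw [hZ.add_apply ha, sub_self]
  have := is_const_of_deriv_eq_zero (fun s => (hd s).differentiableAt)
    (fun s => (hd s).deriv) s 0
  simp only [zero_add, timeIntegral_zero, sub_zero] at this
  linarith

theorem contDiff_timeIntegral (hZ : IsScalarFlow a Z) (ha : ContDiff ℝ ∞ a)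
    (hc : HasCompactSupport a) {h : ℝ → ℝ} (hh : ContDiff ℝ ∞ h) :
    ContDiff ℝ ∞ fun p : ℝ × ℝ => timeIntegral Z h p.1 p.2 :=
  contDiff_infty.2 fun n => contDiff_integral_zero_to n
    ((hh.of_le (by exact_mod_cast le_top)).comp (hZ.contDiff_nat ha hc n))

/-- If along one trajectory of `Z₁` the field `a₁` is `κ` times `a₂`, then this trajectory is a
time change of the trajectory of `Z₂`. -/
theorem apply_integral_eq {a₁ a₂ κ : ℝ → ℝ} {Z₁ Z₂ : ℝ → ℝ → ℝ} (h₁ : IsScalarFlow a₁ Z₁)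
    (h₂ : IsScalarFlow a₂ Z₂) (ha₂ : ContDiff ℝ 1 a₂) (hκ : Continuous κ) {z : ℝ}
    (ha : ∀ t, a₁ (Z₁ t z) = κ t * a₂ (Z₁ t z)) (t : ℝ) :
    Z₂ (∫ s in (0 : ℝ)..t, κ s) z = Z₁ t z := by
  refine eq_of_hasDerivAt (y₁ := fun t => Z₂ (∫ s in (0 : ℝ)..t, κ s) z) ha₂ hκ (fun t => ?_)
    (fun t => (h₁.hasDerivAt z t).congr_deriv (ha t)) (by simp [h₁.zero_apply, h₂.zero_apply]) t
  have hI : HasDerivAt (fun t => ∫ s in (0 : ℝ)..t, κ s) (κ t) t :=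
    (hκ.integral_hasStrictDerivAt 0 t).hasDerivAt
  exact ((h₂.hasDerivAt z _).comp t hI).congr_deriv (mul_comm _ _)

theorem timeIntegral_integral_eq {a₁ a₂ κ k₁ k₂ : ℝ → ℝ} {Z₁ Z₂ : ℝ → ℝ → ℝ}
    (h₁ : IsScalarFlow a₁ Z₁) (h₂ : IsScalarFlow a₂ Z₂) (ha₂ : ContDiff ℝ 1 a₂)
    (hκ : Continuous κ) {z : ℝ} (ha : ∀ t, a₁ (Z₁ t z) = κ t * a₂ (Z₁ t z))
    (hk₁ : Continuous k₁) (hk₂ : Continuous k₂) (hk : ∀ t, k₁ (Z₁ t z) = κ t * k₂ (Z₁ t z))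
    (t : ℝ) : timeIntegral Z₂ k₂ (∫ s in (0 : ℝ)..t, κ s) z = timeIntegral Z₁ k₁ t z := by
  have hI : ∀ t, HasDerivAt (fun t => ∫ s in (0 : ℝ)..t, κ s) (κ t) t := fun t =>
    (hκ.integral_hasStrictDerivAt 0 t).hasDerivAt
  have hd : ∀ t, HasDerivAt (fun t => timeIntegral Z₂ k₂ (∫ s in (0 : ℝ)..t, κ s) z
      - timeIntegral Z₁ k₁ t z) 0 t := fun t => by
    refine (((h₂.hasDerivAt_timeIntegral hk₂ z _).comp t (hI t)).sub
      (h₁.hasDerivAt_timeIntegral hk₁ z t)).congr_deriv ?_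
    rw [h₁.apply_integral_eq h₂ ha₂ hκ ha, hk]
    ring
  have := is_const_of_deriv_eq_zero (fun s => (hd s).differentiableAt)
    (fun s => (hd s).deriv) t 0
  simpa [sub_eq_zero] using this

end IsScalarFlow

/-- The unit sphere of `ℝ³`. -/
local notation "S2" => Metric.sphere (0 : EuclideanSpace ℝ (Fin 3)) 1

theorem mem_sphere_iff_sum_sq (x : EuclideanSpace ℝ (Fin 3)) :
    x ∈ Metric.sphere (0 : EuclideanSpace ℝ (Fin 3)) 1 ↔ x 0 ^ 2 + x 1 ^ 2 + x 2 ^ 2 = 1 := by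
  rw [EuclideanSpace.sphere_zero_eq _ zero_le_one]
  simp [Fin.sum_univ_three]

theorem sum_sq_eq_one (x : S2) : x.1 0 ^ 2 + x.1 1 ^ 2 + x.1 2 ^ 2 = 1 :=
  (mem_sphere_iff_sum_sq x.1).1 x.2

/-- The data defining a flow on the sphere: on heights it is the flow `Z` of `(1 - z ^ 2) * c z`,
and it turns around the vertical axis with angular velocity `b z`. -/
structure SkewData (c b : ℝ → ℝ) (Z : ℝ → ℝ → ℝ) : Prop where
  contDiff_c : ContDiff ℝ ∞ c
  hasCompactSupport_c : HasCompactSupport c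
  contDiff_b : ContDiff ℝ ∞ b
  isScalarFlow : IsScalarFlow (fun z => (1 - z ^ 2) * c z) Z

/-- The flow on `ℝ³` associated with `SkewData`. -/
noncomputable def skewMap (c b : ℝ → ℝ) (Z : ℝ → ℝ → ℝ) (t : ℝ) (p : EuclideanSpace ℝ (Fin 3)) :
    EuclideanSpace ℝ (Fin 3) :=
  !₂[Real.exp (timeIntegral Z (fun z => -(z * c z)) t (p 2)) *
      (p 0 * Real.cos (timeIntegral Z b t (p 2)) - p 1 * Real.sin (timeIntegral Z b t (p 2))),
    Real.exp (timeIntegral Z (fun z => -(z * c z)) t (p 2)) *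
      (p 0 * Real.sin (timeIntegral Z b t (p 2)) + p 1 * Real.cos (timeIntegral Z b t (p 2))),
    Z t (p 2)]

namespace SkewData

variable {c b : ℝ → ℝ} {Z : ℝ → ℝ → ℝ}

theorem contDiff_field (h : SkewData c b Z) : ContDiff ℝ ∞ fun z => (1 - z ^ 2) * c z :=
  (contDiff_const.sub (contDiff_id.pow 2)).mul h.contDiff_c

theorem contDiff_field_one (h : SkewData c b Z) : ContDiff ℝ 1 fun z => (1 - z ^ 2) * c z :=
  h.contDiff_field.of_le (by exact_mod_cast le_top)

theorem hasCompactSupport_field (h : SkewData c b Z) :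
    HasCompactSupport fun z => (1 - z ^ 2) * c z :=
  h.hasCompactSupport_c.mul_left

theorem contDiff_dilation (h : SkewData c b Z) : ContDiff ℝ ∞ fun z => -(z * c z) :=
  (contDiff_id.mul h.contDiff_c).neg

theorem one_sub_sq (h : SkewData c b Z) (t z : ℝ) : 1 - Z t z ^ 2 =
    (1 - z ^ 2) * Real.exp (timeIntegral Z (fun z => -(z * c z)) t z) ^ 2 := by
  have hk : Continuous fun s => 2 * -(Z s z * c (Z s z)) := by
    have := h.isScalarFlow.continuous_time z
    have := h.contDiff_c.continuous
    fun_prop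
  have := eq_mul_exp_of_hasDerivAt_mul (D := fun t => 1 - Z t z ^ 2) hk (fun t => by
    refine (((h.isScalarFlow.hasDerivAt z t).pow 2).const_sub 1).congr_deriv ?_
    push_cast
    ring) t
  rw [intervalIntegral.integral_const_mul, h.isScalarFlow.zero_apply] at this
  rw [this, ← Real.exp_nat_mul]
  rfl

theorem skewMap_mem_sphere (h : SkewData c b Z) (t : ℝ) {p : EuclideanSpace ℝ (Fin 3)}
    (hp : p ∈ S2) : skewMap c b Z t p ∈ S2 := by
  rw [mem_sphere_iff_sum_sq] at hp ⊢
  have h1 := h.one_sub_sq t (p 2)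
  have h2 := Real.sin_sq_add_cos_sq (timeIntegral Z b t (p 2))
  simp only [skewMap, PiLp.toLp_apply, Matrix.cons_val_zero, Matrix.cons_val_one,
    Matrix.cons_val]
  generalize Real.exp _ = ρ at *
  generalize Real.sin _ = s at *
  generalize Real.cos _ = k at *
  linear_combination ρ ^ 2 * (p 0 ^ 2 + p 1 ^ 2) * h2 - h1 + ρ ^ 2 * hp

theorem skewMap_zero (h : SkewData c b Z) (p : EuclideanSpace ℝ (Fin 3)) :
    skewMap c b Z 0 p = p := by
  ext i
  fin_cases i <;> simp [skewMap, h.isScalarFlow.zero_apply]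

theorem skewMap_add (h : SkewData c b Z) (s t : ℝ) (p : EuclideanSpace ℝ (Fin 3)) :
    skewMap c b Z (s + t) p = skewMap c b Z s (skewMap c b Z t p) := by
  have hi : ∀ {k : ℝ → ℝ}, ContDiff ℝ ∞ k → ∀ z, timeIntegral Z k (s + t) z =
      timeIntegral Z k t z + timeIntegral Z k s (Z t z) := fun hk z =>
    h.isScalarFlow.timeIntegral_add h.contDiff_field_one hk.continuous s t z
  ext i
  fin_cases i <;> simp [skewMap, h.isScalarFlow.add_apply h.contDiff_field_one,
    hi h.contDiff_b, hi h.contDiff_dilation, Real.exp_add, Real.cos_add, Real.sin_add] <;> ring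

theorem contDiff_skewMap (h : SkewData c b Z) :
    ContDiff ℝ ∞ fun q : ℝ × EuclideanSpace ℝ (Fin 3) => skewMap c b Z q.1 q.2 := by
  have hi : ∀ {k : ℝ → ℝ}, ContDiff ℝ ∞ k → ContDiff ℝ ∞
      fun q : ℝ × EuclideanSpace ℝ (Fin 3) => timeIntegral Z k q.1 (q.2 2) := fun hk =>
    (h.isScalarFlow.contDiff_timeIntegral h.contDiff_field h.hasCompactSupport_field hk).comp
      (by fun_prop : ContDiff ℝ ∞ fun q : ℝ × EuclideanSpace ℝ (Fin 3) => (q.1, q.2 2))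
  have hz : ContDiff ℝ ∞ fun q : ℝ × EuclideanSpace ℝ (Fin 3) => Z q.1 (q.2 2) :=
    (h.isScalarFlow.contDiff h.contDiff_field h.hasCompactSupport_field).comp
      (by fun_prop : ContDiff ℝ ∞ fun q : ℝ × EuclideanSpace ℝ (Fin 3) => (q.1, q.2 2))
  have hb := hi h.contDiff_b
  have hc := hi h.contDiff_dilation
  rw [contDiff_euclidean]
  intro i
  fin_cases i <;> simp only [skewMap, PiLp.toLp_apply, Fin.zero_eta, Fin.mk_one, Fin.reduceFinMk,
    Matrix.cons_val_zero, Matrix.cons_val_one, Matrix.cons_val]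
  · fun_prop
  · fun_prop
  · exact hz

/-- The flow on the sphere associated with `SkewData`. -/
noncomputable def sphereFlow (h : SkewData c b Z) (t : ℝ) (x : S2) : S2 :=
  ⟨skewMap c b Z t x.1, h.skewMap_mem_sphere t x.2⟩

theorem contMDiff_sphereFlow (h : SkewData c b Z) :
    ContMDiff (𝓘(ℝ, ℝ).prod (𝓡 2)) (𝓡 2) (⊤ : ℕ∞) (fun p : ℝ × S2 => h.sphereFlow p.1 p.2) := by
  have : Fact (Module.finrank ℝ (EuclideanSpace ℝ (Fin 3)) = 2 + 1) := ⟨by simp⟩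
  refine ContMDiff.codRestrict_sphere (n := 2)
    (f := fun p : ℝ × S2 => skewMap c b Z p.1 p.2.1) ?_ _
  exact h.contDiff_skewMap.contMDiff.comp
    (contMDiff_fst.prodMk_space (contMDiff_coe_sphere.comp contMDiff_snd))

theorem isFlow_sphereFlow (h : SkewData c b Z) : IsFlow h.sphereFlow :=
  ⟨h.contMDiff_sphereFlow.continuous, fun x => Subtype.ext (h.skewMap_zero x.1),
    fun s t x => Subtype.ext (h.skewMap_add s t x.1)⟩

theorem skewMap_integral_eq {c₁ b₁ c₂ b₂ κ : ℝ → ℝ} {Z₁ Z₂ : ℝ → ℝ → ℝ} (h₁ : SkewData c₁ b₁ Z₁)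
    (h₂ : SkewData c₂ b₂ Z₂) (p : EuclideanSpace ℝ (Fin 3)) (hκ : Continuous κ)
    (hc : ∀ t, c₁ (Z₁ t (p 2)) = κ t * c₂ (Z₁ t (p 2)))
    (hb : ∀ t, b₁ (Z₁ t (p 2)) = κ t * b₂ (Z₁ t (p 2))) (t : ℝ) :
    skewMap c₂ b₂ Z₂ (∫ s in (0 : ℝ)..t, κ s) p = skewMap c₁ b₁ Z₁ t p := by
  have ha : ∀ t, (fun z => (1 - z ^ 2) * c₁ z) (Z₁ t (p 2)) =
      κ t * (fun z => (1 - z ^ 2) * c₂ z) (Z₁ t (p 2)) := fun t => by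
    simp only [hc]
    ring
  have hi := h₁.isScalarFlow.timeIntegral_integral_eq h₂.isScalarFlow h₂.contDiff_field_one hκ ha
    h₁.contDiff_b.continuous h₂.contDiff_b.continuous hb t
  have hj := h₁.isScalarFlow.timeIntegral_integral_eq h₂.isScalarFlow h₂.contDiff_field_one hκ ha
    h₁.contDiff_dilation.continuous h₂.contDiff_dilation.continuous
    (fun t => by rw [hc]; ring) t
  have hz := h₁.isScalarFlow.apply_integral_eq h₂.isScalarFlow h₂.contDiff_field_one hκ ha t
  simp only [skewMap, hi, hj, hz]

end SkewData

theorem exists_rotation_eq {u v u' v' : ℝ} (h : u ^ 2 + v ^ 2 = u' ^ 2 + v' ^ 2) :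
    ∃ θ : ℝ, u * Real.cos θ - v * Real.sin θ = u' ∧ u * Real.sin θ + v * Real.cos θ = v' := by
  have hn : ‖(⟨u, v⟩ : ℂ)‖ = ‖(⟨u', v'⟩ : ℂ)‖ := by
    rw [Complex.norm_eq_sqrt_sq_add_sq, Complex.norm_eq_sqrt_sq_add_sq, h]
  obtain ⟨θ, hθ⟩ : ∃ θ : ℝ, (⟨u, v⟩ : ℂ) * Complex.exp (θ * Complex.I) = ⟨u', v'⟩ := by
    by_cases h0 : (⟨u, v⟩ : ℂ) = 0
    · refine ⟨0, ?_⟩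
      rw [h0, norm_zero, eq_comm, norm_eq_zero] at hn
      rw [h0, hn, zero_mul]
    · obtain ⟨θ, hθ⟩ := (Complex.norm_eq_one_iff ((⟨u', v'⟩ : ℂ) / ⟨u, v⟩)).1 (by
        rw [norm_div, hn, div_self (hn ▸ norm_ne_zero_iff.2 h0)])
      exact ⟨θ, by rw [hθ, mul_div_cancel₀ _ h0]⟩
  refine ⟨θ, ?_, ?_⟩
  · simpa [Complex.exp_ofReal_mul_I_re, Complex.exp_ofReal_mul_I_im] using congrArg Complex.re hθ
  · simpa [Complex.exp_ofReal_mul_I_re, Complex.exp_ofReal_mul_I_im] using congrArg Complex.im hθ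

theorem height_mem_Icc (x : S2) : x.1 2 ∈ Icc (-1 : ℝ) 1 := by
  have := sum_sq_eq_one x
  exact abs_le.1 ((sq_le_one_iff_abs_le_one _).1 (by
    nlinarith [sq_nonneg (x.1 0), sq_nonneg (x.1 1)]))

/-- The heights of the circles that are periodic orbits; they accumulate at the north pole. -/
noncomputable def latitude (n : ℕ) : ℝ := 1 - 1 / (n + 2)

theorem one_sub_latitude (n : ℕ) : 1 - latitude n = 1 / (n + 2) := sub_sub_cancel _ _

theorem latitude_mem_Ioo (n : ℕ) : latitude n ∈ Ioo (-1 : ℝ) 1 := by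
  have h1 := one_sub_latitude n
  have h2 : (0 : ℝ) < 1 / (n + 2) := by positivity
  have h3 : (1 : ℝ) / (n + 2) ≤ 1 := by
    rw [div_le_one (by positivity)]
    linarith [(n.cast_nonneg : (0 : ℝ) ≤ n)]
  constructor <;> linarith

theorem tendsto_latitude : Tendsto latitude atTop (𝓝 1) := by
  have h : Tendsto (fun n : ℕ => ((n : ℝ) + 2)) atTop atTop :=
    tendsto_atTop_add_const_right _ _ tendsto_natCast_atTop_atTop
  have h' := h.inv_tendsto_atTop.const_sub 1
  rw [sub_zero] at h'
  exact h'.congr fun n => by simp [latitude]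

theorem latitude_injective : Function.Injective latitude := fun m n h => by
  have h1 : (1 : ℝ) / (m + 2) = 1 / (n + 2) := by rw [← one_sub_latitude, h, one_sub_latitude]
  have h2 := (div_eq_div_iff (by positivity) (by positivity)).1 h1
  exact_mod_cast (by linarith : (m : ℝ) = n)

theorem exists_contDiff_support_eq_diff_latitude : ∃ c : ℝ → ℝ, ContDiff ℝ ∞ c ∧
    HasCompactSupport c ∧ (∀ z, 0 ≤ c z) ∧
      Function.support c = Ioo (-1) 1 \ range latitude := by
  have hK : IsClosed (insert 1 (range latitude)) :=
    tendsto_latitude.isCompact_insert_range.isClosed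
  obtain ⟨c, hs, hd, h0⟩ := (isOpen_Ioo.sdiff hK :
    IsOpen (Ioo (-1 : ℝ) 1 \ _)).exists_contDiff_support_eq (n := (⊤ : ℕ∞))
  have hs' : Function.support c = Ioo (-1) 1 \ range latitude := by
    rw [hs]
    ext z
    simp only [Set.mem_sdiff, mem_insert_iff, not_or, and_congr_right_iff, and_iff_right_iff_imp]
    exact fun hz _ => hz.2.ne
  refine ⟨c, hd, HasCompactSupport.of_support_subset_isCompact isCompact_Icc
    (hs'.trans_subset (sdiff_subset.trans Ioo_subset_Icc_self)), fun z => (h0 ⟨z, rfl⟩).1, hs'⟩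

namespace SkewData

variable {c b : ℝ → ℝ} {Z : ℝ → ℝ → ℝ}

theorem apply_of_eq_zero (h : SkewData c b Z) {z : ℝ} (hz : (1 - z ^ 2) * c z = 0) (t : ℝ) :
    Z t z = z :=
  h.isScalarFlow.apply_of_eq_zero h.contDiff_field_one hz t

theorem skewMap_of_eq_zero (h : SkewData c b Z) {p : EuclideanSpace ℝ (Fin 3)}
    (hp : c (p 2) = 0) (t : ℝ) : skewMap c b Z t p =
      !₂[p 0 * Real.cos (t * b (p 2)) - p 1 * Real.sin (t * b (p 2)),
        p 0 * Real.sin (t * b (p 2)) + p 1 * Real.cos (t * b (p 2)), p 2] := by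
  have hZ := h.apply_of_eq_zero (z := p 2) (by rw [hp, mul_zero])
  simp [skewMap, timeIntegral, hZ, hp]

theorem flowOrbit_eq (h : SkewData c b Z) {x : S2} (hx : c (x.1 2) = 0)
    (hb : b (x.1 2) ≠ 0 ∨ x.1 2 ^ 2 = 1) : flowOrbit h.sphereFlow x = {y | y.1 2 = x.1 2} := by
  ext y
  have h1 := sum_sq_eq_one x
  have h2 := sum_sq_eq_one y
  have hf := h.skewMap_of_eq_zero hx
  constructor
  · rintro ⟨t, rfl⟩
    simp [sphereFlow, hf]
  · intro hy
    change y.1 2 = x.1 2 at hy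
    rw [hy] at h2
    suffices ∃ t, x.1 0 * Real.cos (t * b (x.1 2)) - x.1 1 * Real.sin (t * b (x.1 2)) = y.1 0 ∧
        x.1 0 * Real.sin (t * b (x.1 2)) + x.1 1 * Real.cos (t * b (x.1 2)) = y.1 1 by
      obtain ⟨t, h3, h4⟩ := this
      refine ⟨t, Subtype.ext ?_⟩
      change skewMap c b Z t x.1 = y.1
      rw [hf, h3, h4, ← hy]
      ext i
      fin_cases i <;> rfl
    rcases hb with hb | hb
    · obtain ⟨θ, hθ⟩ := exists_rotation_eq
        (by linarith : x.1 0 ^ 2 + x.1 1 ^ 2 = y.1 0 ^ 2 + y.1 1 ^ 2)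
      exact ⟨θ / b (x.1 2), by rwa [div_mul_cancel₀ _ hb]⟩
    · have hz : ∀ {u v : ℝ}, u ^ 2 + v ^ 2 + x.1 2 ^ 2 = 1 → u = 0 ∧ v = 0 := fun {u v} huv =>
        ⟨by nlinarith [sq_nonneg u, sq_nonneg v], by nlinarith [sq_nonneg u, sq_nonneg v]⟩
      simp [hz h1, hz h2]

theorem eq_zero_of_sphereFlow_eq (h : SkewData c b Z) (hc : ∀ z, 0 ≤ c z)
    (hs : Function.support c ⊆ Ioo (-1) 1) {x : S2} {s : ℝ} (hs0 : 0 < s)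
    (hx : h.sphereFlow s x = x) : c (x.1 2) = 0 := by
  have ha : ∀ z, 0 ≤ (1 - z ^ 2) * c z := fun z => by
    by_cases hz : c z = 0
    · simp [hz]
    · have := hs hz
      exact mul_nonneg (by nlinarith [this.1, this.2]) (hc z)
  by_contra h0
  have hz : Z s (x.1 2) = x.1 2 := congrArg (fun y : S2 => y.1 2) hx
  have := hs h0
  rcases mul_eq_zero.1 (h.isScalarFlow.eq_zero_of_apply_eq ha hs0 hz) with h1 | h1
  · nlinarith [this.1, this.2]
  · exact h0 h1

theorem height_eq_of_isFlowPeriodicPt (h : SkewData c b Z) (hc : ∀ z, 0 ≤ c z)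
    (hs : Function.support c = Ioo (-1) 1 \ range latitude) {x : S2}
    (hx : IsFlowPeriodicPt h.sphereFlow x) :
    x.1 2 = 1 ∨ x.1 2 = -1 ∨ ∃ n, x.1 2 = latitude n := by
  obtain ⟨s, hs0, hx⟩ := hx
  have h0 := h.eq_zero_of_sphereFlow_eq hc (hs.trans_subset sdiff_subset) hs0 hx
  have h1 : x.1 2 ∉ Ioo (-1) 1 \ range latitude := by rw [← hs]; simpa using h0
  have h2 := height_mem_Icc x
  by_cases h3 : x.1 2 ∈ Ioo (-1 : ℝ) 1
  · by_contra! h4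
    exact h1 ⟨h3, fun ⟨n, hn⟩ => h4.2.2 n hn.symm⟩
  · rcases h2.2.eq_or_lt with h4 | h4
    · exact Or.inl h4
    · rcases h2.1.eq_or_lt with h5 | h5
      · exact Or.inr (Or.inl h5.symm)
      · exact absurd ⟨h5, h4⟩ h3

theorem apply_latitude (hs : Function.support c = Ioo (-1) 1 \ range latitude) (n : ℕ) :
    c (latitude n) = 0 := by
  rw [← Function.notMem_support, hs]
  exact fun h => h.2 ⟨n, rfl⟩

end SkewData

theorem exists_height_eq {z : ℝ} (hz : z ∈ Icc (-1 : ℝ) 1) : ∃ x : S2, x.1 2 = z := by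
  refine ⟨⟨!₂[√(1 - z ^ 2), 0, z], ?_⟩, ?_⟩
  · rw [mem_sphere_iff_sum_sq]
    simp [Real.sq_sqrt (by nlinarith [hz.1, hz.2] : 0 ≤ 1 - z ^ 2)]
  · simp

theorem setOf_height_eq_injOn : InjOn (fun z : ℝ => {y : S2 | y.1 2 = z}) (Icc (-1) 1) := by
  intro z hz w _ h
  obtain ⟨x, hx⟩ := exists_height_eq hz
  have : x ∈ {y : S2 | y.1 2 = w} := by
    exact (congrArg (x ∈ ·) h).mp hx
  exact hx.symm.trans this

namespace SkewData

variable {c : ℝ → ℝ} {Z : ℝ → ℝ → ℝ}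

theorem encard_periodicOrbits_eq_top (h : SkewData c (fun _ => 1) Z) (hc : ∀ z, 0 ≤ c z)
    (hs : Function.support c = Ioo (-1) 1 \ range latitude) {t : ℝ} (ht : 2 * Real.pi ≤ t) :
    (periodicOrbits h.sphereFlow t).encard = ⊤ := by
  rw [Set.encard_eq_top_iff]
  refine Set.infinite_of_injective_forall_mem (f := fun n => {y : S2 | y.1 2 = latitude n})
    (fun m n hmn => latitude_injective (setOf_height_eq_injOn
      (Ioo_subset_Icc_self (latitude_mem_Ioo m)) (Ioo_subset_Icc_self (latitude_mem_Ioo n)) hmn))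
    fun n => ?_
  obtain ⟨x, hx⟩ := exists_height_eq (Ioo_subset_Icc_self (latitude_mem_Ioo n))
  have hcx : c (x.1 2) = 0 := by rw [hx, apply_latitude hs]
  have ho := h.flowOrbit_eq hcx (Or.inl one_ne_zero)
  refine ⟨x, by rw [ho, hx], ⟨2 * Real.pi, by positivity, ht, Subtype.ext ?_⟩,
    {y | (1 - y.1 2) * (n + 1) < 1 ∧ 1 < (1 - y.1 2) * (n + 3)}, ?_, ?_, ?_⟩
  · change skewMap c (fun _ => 1) Z (2 * Real.pi) x.1 = x.1
    rw [h.skewMap_of_eq_zero hcx]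
    ext i
    fin_cases i <;> simp
  · have hz : Continuous fun y : S2 => y.1 2 := by fun_prop
    exact (isOpen_lt (f := fun y : S2 => (1 - y.1 2) * (n + 1)) (by fun_prop)
      continuous_const).inter
      (isOpen_lt (g := fun y : S2 => (1 - y.1 2) * (n + 3)) continuous_const (by fun_prop))
  · rw [ho, hx]
    intro y hy
    change y.1 2 = latitude n at hy
    have hp : (0 : ℝ) < n + 2 := by positivity
    simp only [mem_ofPred_eq, hy, one_sub_latitude, div_mul_eq_mul_div, one_mul, div_lt_one hp,
      one_lt_div hp]
    constructor <;> linarith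
  · rintro y ⟨hy1, hy2⟩ hy
    rw [ho, hx, mem_ofPred_eq]
    have hn : (0 : ℝ) ≤ n := n.cast_nonneg
    rcases h.height_eq_of_isFlowPeriodicPt hc hs hy with hz | hz | ⟨m, hz⟩
    · rw [hz] at hy2
      linarith
    · rw [hz] at hy1
      linarith
    · have hp : (0 : ℝ) < m + 2 := by positivity
      simp only [hz, one_sub_latitude, div_mul_eq_mul_div, one_mul, div_lt_one hp,
        one_lt_div hp] at hy1 hy2
      have h1 : n < m + 1 := by exact_mod_cast (by linarith : (n : ℝ) < m + 1)
      have h2 : m < n + 1 := by exact_mod_cast (by linarith : (m : ℝ) < n + 1)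
      rw [hz, show m = n by omega]

theorem EP_eq_top (h : SkewData c (fun _ => 1) Z) (hc : ∀ z, 0 ≤ c z)
    (hs : Function.support c = Ioo (-1) 1 \ range latitude) : EP h.sphereFlow = ⊤ := by
  have : (fun t : ℝ => ENNReal.ofReal (1 / t) * elog (periodicOrbits h.sphereFlow t).encard)
      =ᶠ[atTop] fun _ => ⊤ := by
    filter_upwards [eventually_ge_atTop (2 * Real.pi)] with t ht
    have ht0 : 0 < t := by linarith [Real.pi_pos]
    rw [h.encard_periodicOrbits_eq_top hc hs ht, elog, if_pos rfl]
    exact ENNReal.mul_top (by simpa using ht0)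
  rw [EP, limsup_congr this, limsup_const]

theorem natCast_le_of_sphereFlow_eq (h : SkewData c (fun z => 1 - z) Z)
    (hs : Function.support c = Ioo (-1) 1 \ range latitude) {x : S2} {n : ℕ}
    (hx : x.1 2 = latitude n) {s : ℝ} (hs0 : 0 < s) (hsx : h.sphereFlow s x = x) :
    (n : ℝ) ≤ s := by
  have hcx : c (x.1 2) = 0 := by rw [hx, apply_latitude hs]
  have hm : skewMap c (fun z => 1 - z) Z s x.1 = x.1 := congrArg Subtype.val hsx
  rw [h.skewMap_of_eq_zero hcx, hx, one_sub_latitude] at hm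
  have h0 := congrArg (fun p : EuclideanSpace ℝ (Fin 3) => p 0) hm
  have h1 := congrArg (fun p : EuclideanSpace ℝ (Fin 3) => p 1) hm
  simp only [Matrix.cons_val_zero, Matrix.cons_val_one] at h0 h1
  have hsum := sum_sq_eq_one x
  have hl := latitude_mem_Ioo n
  rw [hx] at hsum
  have hr : 0 < x.1 0 ^ 2 + x.1 1 ^ 2 := by nlinarith [hl.1, hl.2]
  have hcos : Real.cos (s * (1 / (n + 2))) = 1 := by
    refine mul_left_cancel₀ hr.ne' ?_
    linear_combination x.1 0 * h0 + x.1 1 * h1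
  by_contra! hlt
  have hp : (0 : ℝ) < n + 2 := by positivity
  have hθ : 0 < s * (1 / (n + 2)) := by positivity
  have hθ' : s * (1 / (n + 2)) < 2 * Real.pi := by
    rw [mul_one_div, div_lt_iff₀ hp]
    nlinarith [Real.pi_gt_three]
  exact hθ.ne' ((Real.cos_eq_one_iff_of_lt_of_lt (by linarith [Real.pi_pos]) hθ').1 hcos)

theorem encard_periodicOrbits_le (h : SkewData c (fun z => 1 - z) Z) (hc : ∀ z, 0 ≤ c z)
    (hs : Function.support c = Ioo (-1) 1 \ range latitude) {t : ℝ} :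
    (periodicOrbits h.sphereFlow t).encard ≤ ((⌊t⌋₊ + 3 : ℕ) : ℕ∞) := by
  have hc1 : ∀ z : ℝ, z ^ 2 = 1 → c z = 0 := fun z hz => by
    rw [← Function.notMem_support, hs]
    exact fun h => by nlinarith [h.1.1, h.1.2]
  have hsub : periodicOrbits h.sphereFlow t ⊆ (fun z : ℝ => {y : S2 | y.1 2 = z}) ''
      ({1, -1} ∪ latitude '' ↑(Finset.range (⌊t⌋₊ + 1))) := by
    rintro _ ⟨x, rfl, ⟨s, hs0, hst, hsx⟩, -⟩
    refine ⟨x.1 2, ?_, ?_⟩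
    · rcases h.height_eq_of_isFlowPeriodicPt hc hs ⟨s, hs0, hsx⟩ with hz | hz | ⟨m, hz⟩
      · simp [hz]
      · simp [hz]
      · refine Or.inr ⟨m, ?_, hz.symm⟩
        have := Nat.le_floor ((h.natCast_le_of_sphereFlow_eq hs hz hs0 hsx).trans hst)
        simpa [Nat.lt_succ_iff] using this
    · refine (h.flowOrbit_eq
        (h.eq_zero_of_sphereFlow_eq hc (hs.trans_subset sdiff_subset) hs0 hsx) ?_).symm
      by_cases h1 : x.1 2 = 1
      · exact Or.inr (by simp [h1])
      · exact Or.inl (sub_ne_zero.2 (Ne.symm h1))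
  calc (periodicOrbits h.sphereFlow t).encard
      ≤ ({1, -1} ∪ latitude '' ↑(Finset.range (⌊t⌋₊ + 1)) : Set ℝ).encard :=
        (encard_le_encard hsub).trans (encard_image_le _ _)
    _ ≤ 2 + ((⌊t⌋₊ + 1 : ℕ) : ℕ∞) := by
        refine (encard_union_le _ _).trans (add_le_add (encard_pair (by norm_num)).le ?_)
        refine (encard_image_le _ _).trans_eq ?_
        rw [encard_coe_eq_coe_finsetCard, Finset.card_range]
    _ = ((⌊t⌋₊ + 3 : ℕ) : ℕ∞) := by
        push_cast
        ring

end SkewData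

theorem elog_le {n : ℕ∞} {m : ℕ} (h : n ≤ m) : elog n ≤ ENNReal.ofReal (Real.log m) := by
  lift n to ℕ using ne_top_of_le_ne_top (ENat.natCast_ne_top m) h
  have h' : n ≤ m := by exact_mod_cast h
  rw [elog, if_neg (ENat.natCast_ne_top n), ENat.toNat_natCast]
  refine ENNReal.ofReal_le_ofReal ?_
  rcases n.eq_zero_or_pos with rfl | hn
  · simpa using Real.log_natCast_nonneg m
  · exact Real.log_le_log (by exact_mod_cast hn) (by exact_mod_cast h')

theorem tendsto_log_add_three_div : Tendsto (fun t : ℝ => Real.log (t + 3) / t) atTop (𝓝 0) := by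
  have h1 : Tendsto (fun t : ℝ => 2 * (Real.log (t + 3) / (t + 3))) atTop (𝓝 0) := by
    simpa using ((Real.isLittleO_log_id_atTop.tendsto_div_nhds_zero).comp
      (tendsto_atTop_add_const_right atTop (3 : ℝ) tendsto_id)).const_mul 2
  refine squeeze_zero' ?_ ?_ h1
  · filter_upwards [eventually_ge_atTop 3] with t ht
    exact div_nonneg (Real.log_nonneg (by linarith)) (by linarith)
  · filter_upwards [eventually_ge_atTop 3] with t ht
    have := Real.log_nonneg (by linarith : 1 ≤ t + 3)
    rw [← mul_div_assoc, div_le_div_iff₀ (by linarith) (by linarith)]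
    nlinarith

theorem SkewData.EP_eq_zero {c : ℝ → ℝ} {Z : ℝ → ℝ → ℝ} (h : SkewData c (fun z => 1 - z) Z)
    (hc : ∀ z, 0 ≤ c z) (hs : Function.support c = Ioo (-1) 1 \ range latitude) :
    EP h.sphereFlow = 0 := by
  refine Tendsto.limsup_eq (tendsto_of_tendsto_of_tendsto_of_le_of_le' tendsto_const_nhds
    (by simpa using ENNReal.tendsto_ofReal tendsto_log_add_three_div)
    (Eventually.of_forall fun t => zero_le) ?_)
  filter_upwards [eventually_gt_atTop 0] with t ht
  calc ENNReal.ofReal (1 / t) * elog (periodicOrbits h.sphereFlow t).encard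
      ≤ ENNReal.ofReal (1 / t) * ENNReal.ofReal (Real.log (⌊t⌋₊ + 3 : ℕ)) := by
        gcongr
        exact elog_le (h.encard_periodicOrbits_le hc hs)
    _ ≤ ENNReal.ofReal (1 / t) * ENNReal.ofReal (Real.log (t + 3)) := by
        gcongr
        push_cast
        linarith [Nat.floor_le ht.le]
    _ = ENNReal.ofReal (Real.log (t + 3) / t) := by
        rw [← ENNReal.ofReal_mul (by positivity), one_div_mul_eq_div]

theorem flowEquiv_of_forall_exists {M : Type*} [TopologicalSpace M] {φ ψ : ℝ → M → M}
    (h₁ : ∀ x t, ∃ τ, (0 ≤ t → 0 ≤ τ) ∧ ψ τ x = φ t x)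
    (h₂ : ∀ x t, ∃ τ, (0 ≤ t → 0 ≤ τ) ∧ φ τ x = ψ t x) : FlowEquiv φ ψ := by
  refine ⟨Homeomorph.refl M, fun x => ⟨(image_id _).trans ?_, (image_id _).trans ?_⟩⟩
  · refine Subset.antisymm ?_ ?_
    · rintro _ ⟨t, rfl⟩
      exact (h₁ x t).imp fun _ h => h.2
    · rintro _ ⟨t, rfl⟩
      exact (h₂ x t).imp fun _ h => h.2
  · refine Subset.antisymm ?_ ?_
    · rintro _ ⟨t, ht, rfl⟩
      exact (h₁ x t).imp fun _ h => ⟨h.1 ht, h.2⟩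
    · rintro _ ⟨t, ht, rfl⟩
      exact (h₂ x t).imp fun _ h => ⟨h.1 ht, h.2⟩

namespace SkewData

variable {c b c₁ b₁ c₂ b₂ : ℝ → ℝ} {Z Z₁ Z₂ : ℝ → ℝ → ℝ}

theorem lt_one (h : SkewData c b Z) {z : ℝ} (hz : z < 1) (t : ℝ) : Z t z < 1 := by
  have h1 := h.isScalarFlow.sub_eq h.contDiff_field_one t 1 z
  rw [h.apply_of_eq_zero (by simp)] at h1
  exact sub_pos.1 (h1 ▸ mul_pos (sub_pos.2 hz) (Real.exp_pos _))

/-- If the two fields are proportional away from the north pole, with a positive factor `κ`, then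
the orbits of the first flow are contained in those of the second, with the same orientation. -/
theorem exists_sphereFlow_eq (h₁ : SkewData c₁ b₁ Z₁) (h₂ : SkewData c₂ b₂ Z₂) {κ : ℝ → ℝ}
    (hκ : ContinuousOn κ (Iio 1)) (hκ0 : ∀ z < 1, 0 ≤ κ z) (hc : ∀ z < 1, c₁ z = κ z * c₂ z)
    (hb : ∀ z < 1, b₁ z = κ z * b₂ z) (hc₁ : c₁ 1 = 0) (hc₂ : c₂ 1 = 0) (x : S2) (t : ℝ) :
    ∃ τ, (0 ≤ t → 0 ≤ τ) ∧ h₂.sphereFlow τ x = h₁.sphereFlow t x := by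
  rcases (height_mem_Icc x).2.eq_or_lt with hx | hx
  · refine ⟨t, id, Subtype.ext ?_⟩
    have hsum := sum_sq_eq_one x
    rw [hx] at hsum
    have h0 : x.1 0 = 0 := by nlinarith [sq_nonneg (x.1 0), sq_nonneg (x.1 1)]
    have h1 : x.1 1 = 0 := by nlinarith [sq_nonneg (x.1 0), sq_nonneg (x.1 1)]
    change skewMap c₂ b₂ Z₂ t x.1 = skewMap c₁ b₁ Z₁ t x.1
    rw [h₁.skewMap_of_eq_zero (by rw [hx, hc₁]), h₂.skewMap_of_eq_zero (by rw [hx, hc₂])]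
    simp [h0, h1]
  · refine ⟨∫ s in (0 : ℝ)..t, κ (Z₁ s (x.1 2)), fun ht =>
      intervalIntegral.integral_nonneg ht fun s _ => hκ0 _ (h₁.lt_one hx s), Subtype.ext ?_⟩
    exact h₁.skewMap_integral_eq h₂ x.1
      (hκ.comp_continuous (h₁.isScalarFlow.continuous_time _) fun s => h₁.lt_one hx s)
      (fun s => hc _ (h₁.lt_one hx s)) (fun s => hb _ (h₁.lt_one hx s)) t

end SkewData

theorem exists_skewData {c b : ℝ → ℝ} (hc : ContDiff ℝ ∞ c) (hcs : HasCompactSupport c)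
    (hb : ContDiff ℝ ∞ b) : ∃ Z, SkewData c b Z := by
  obtain ⟨Z, hZ⟩ := exists_isScalarFlow (a := fun z => (1 - z ^ 2) * c z)
    (((contDiff_const.sub (contDiff_id.pow 2)).mul hc).of_le (by exact_mod_cast le_top))
    hcs.mul_left
  exact ⟨Z, hc, hcs, hb, hZ⟩

/-- **Theorem A.** There exist two equivalent `C^∞` flows `φ` and `φ̂` on the sphere `𝕊²`
with `EP(φ) = 0` and `EP(φ̂) = ∞`. -/
theorem exists_equivalent_smooth_flows_on_sphere_EP_zero_and_infty :
    ∃ φ φ' : ℝ → (Metric.sphere (0 : EuclideanSpace ℝ (Fin 3)) 1) →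
        (Metric.sphere (0 : EuclideanSpace ℝ (Fin 3)) 1),
      IsFlow φ ∧ IsFlow φ' ∧
      ContMDiff (𝓘(ℝ, ℝ).prod (𝓡 2)) (𝓡 2) (⊤ : ℕ∞)
        (fun p : ℝ × (Metric.sphere (0 : EuclideanSpace ℝ (Fin 3)) 1) => φ p.1 p.2) ∧
      ContMDiff (𝓘(ℝ, ℝ).prod (𝓡 2)) (𝓡 2) (⊤ : ℕ∞)
        (fun p : ℝ × (Metric.sphere (0 : EuclideanSpace ℝ (Fin 3)) 1) => φ' p.1 p.2) ∧
      FlowEquiv φ φ' ∧ EP φ = 0 ∧ EP φ' = ⊤ := by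

  obtain ⟨c, hc, hcs, hc0, hs⟩ := exists_contDiff_support_eq_diff_latitude
  have hb : ContDiff ℝ ∞ fun z : ℝ => 1 - z := contDiff_const.sub contDiff_id
  have hc1 : c 1 = 0 := by
    rw [← Function.notMem_support, hs]
    exact fun h => h.1.2.ne rfl
  have hnz : ∀ z, c z ≠ 0 → z < 1 := fun z hz => (hs.subset hz).1.2
  obtain ⟨Z, h⟩ := exists_skewData (hb.mul hc) hcs.mul_left hb
  obtain ⟨Z', h'⟩ := exists_skewData hc hcs (contDiff_const (c := (1 : ℝ)))
  refine ⟨h.sphereFlow, h'.sphereFlow, h.isFlow_sphereFlow, h'.isFlow_sphereFlow,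
    h.contMDiff_sphereFlow, h'.contMDiff_sphereFlow, flowEquiv_of_forall_exists ?_ ?_,
    h.EP_eq_zero (fun z => ?_) ?_, h'.EP_eq_top hc0 hs⟩
  · exact h.exists_sphereFlow_eq h' hb.continuous.continuousOn
      (fun z hz => (sub_pos.2 hz).le) (fun z _ => rfl) (fun z _ => (mul_one _).symm)
      (by simp) hc1
  · exact h'.exists_sphereFlow_eq h (κ := fun z => (1 - z)⁻¹)
      (hb.continuous.continuousOn.inv₀ fun z hz => (sub_pos.2 hz).ne')
      (fun z hz => inv_nonneg.2 (sub_pos.2 hz).le)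
      (fun z hz => (inv_mul_cancel_left₀ (sub_pos.2 hz).ne' _).symm)
      (fun z hz => (inv_mul_cancel₀ (sub_pos.2 hz).ne').symm) hc1 (by simp)
  · by_cases hz : c z = 0
    · simp [hz]
    · exact mul_nonneg (sub_pos.2 (hnz z hz)).le (hc0 z)
  · rw [← hs]
    ext z
    simp only [Function.mem_support, ne_eq, mul_eq_zero, not_or, and_iff_right_iff_imp]
    exact fun hz => (sub_pos.2 (hnz z hz)).ne'
end

section
/- There exist two flows φ and φ̂ on the plane ℝ², each of class C^∞, such that φ and φ̂ are equivalent, EP(φ) = 0, and EP(φ̂) = ∞; moreover the flows can be chosen so that every isolated periodic orbit of either flow is a round circle centered at the origin of radius at most 1. -/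
open Set Filter Topology Manifold

/-- Integrals over `[0, 1]` depend smoothly on parameters. -/
lemma contDiff_intervalIntegral_zero_one {P : Type} [NormedAddCommGroup P] [NormedSpace ℝ P]
    [FiniteDimensional ℝ P] (n : ℕ) :
    ∀ {E : Type} [NormedAddCommGroup E] [NormedSpace ℝ E] [CompleteSpace E]
      {G : P → ℝ → E}, ContDiff ℝ n (fun z : P × ℝ => G z.1 z.2) →
      ContDiff ℝ n (fun p => ∫ θ in (0 : ℝ)..1, G p θ) := by
  induction n with
  | zero =>
    intro E _ _ _ G hG
    rw [Nat.cast_zero, contDiff_zero] at hG ⊢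
    exact intervalIntegral.continuous_parametric_intervalIntegral_of_continuous' hG 0 1
  | succ n ih =>
    intro E _ _ _ G hG
    have hGc : Continuous (fun z : P × ℝ => G z.1 z.2) := hG.continuous
    let G' : P → ℝ → P →L[ℝ] E := fun p θ =>
      (fderiv ℝ (fun z : P × ℝ => G z.1 z.2) (p, θ)).comp (ContinuousLinearMap.inl ℝ P ℝ)
    have hG' : ContDiff ℝ n (fun z : P × ℝ => G' z.1 z.2) := by
      have := hG.fderiv_right (m := n) (by norm_cast)
      exact this.clm_comp contDiff_const
    have hd : ∀ θ p, HasFDerivAt (fun p => G p θ) (G' p θ) p := by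
      intro θ p
      have h1 : HasFDerivAt (fun z : P × ℝ => G z.1 z.2) (fderiv ℝ _ (p, θ)) (p, θ) :=
        ((hG.differentiable (by simp)) (p, θ)).hasFDerivAt
      exact h1.comp (f := fun q : P => (q, θ)) p (hasFDerivAt_prodMk_left p θ)
    have hc : ∀ p, Continuous (G p) := fun p => by fun_prop
    have hc' : ∀ p, Continuous (G' p) := fun p => by
      have := hG'.continuous
      exact this.comp (Continuous.prodMk_right p)
    push_cast
    rw [contDiff_succ_iff_hasFDerivAt]
    refine ⟨fun p => ∫ θ in (0 : ℝ)..1, G' p θ, ih hG', fun p => ?_⟩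
    have : ProperSpace P := FiniteDimensional.proper ℝ P
    obtain ⟨C, hC⟩ := ((isCompact_closedBall p 1).prod
      (isCompact_Icc (a := (0 : ℝ)) (b := 1))).exists_bound_of_continuousOn
      hG'.continuous.continuousOn
    refine intervalIntegral.hasFDerivAt_integral_of_dominated_of_fderiv_le (F' := G')
      (bound := fun _ => C) (Metric.closedBall_mem_nhds p one_pos)
      (.of_forall fun q => (hc q).aestronglyMeasurable)
      ((hc p).intervalIntegrable _ _) (hc' p).aestronglyMeasurable ?_
      intervalIntegrable_const (.of_forall fun θ _ q _ => hd θ q)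
    refine .of_forall fun θ hθ q hq => hC (q, θ) ⟨hq, ?_⟩
    rw [uIoc_of_le zero_le_one] at hθ
    exact Ioc_subset_Icc_self hθ

/-- Primitives of functions depending on parameters are jointly smooth. -/
lemma contDiff_parametric_primitive {P E : Type} [NormedAddCommGroup P] [NormedSpace ℝ P]
    [FiniteDimensional ℝ P] [NormedAddCommGroup E] [NormedSpace ℝ E] [CompleteSpace E] {n : ℕ}
    {g : ℝ → P → E} (hg : ContDiff ℝ n (fun z : ℝ × P => g z.1 z.2)) :
    ContDiff ℝ n (fun z : ℝ × P => ∫ s in (0 : ℝ)..z.1, g s z.2) := by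
  have h : ContDiff ℝ n (fun z : ℝ × P => z.1 • ∫ θ in (0 : ℝ)..1, g (z.1 * θ) z.2) := by
    refine contDiff_fst.smul
      (contDiff_intervalIntegral_zero_one (G := fun (z : ℝ × P) θ => g (z.1 * θ) z.2) n ?_)
    exact hg.comp (f := fun z : (ℝ × P) × ℝ => (z.1.1 * z.2, z.1.2)) (by fun_prop)
  convert h using 2 with z
  rw [intervalIntegral.smul_integral_comp_mul_left (fun s => g s z.2)]
  simp

/-- The averaged derivative of `F` on the segment from `a` to `b`. -/
noncomputable def meanDeriv (F : ℝ → ℝ) (a b : ℝ) : ℝ :=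
  ∫ θ in (0 : ℝ)..1, deriv F (a + θ * (b - a))

lemma continuous_meanDeriv {F : ℝ → ℝ} (hF : ContDiff ℝ 1 F) :
    Continuous (fun z : ℝ × ℝ => meanDeriv F z.1 z.2) := by
  have := hF.continuous_deriv le_rfl
  exact intervalIntegral.continuous_parametric_intervalIntegral_of_continuous'
    (f := fun (z : ℝ × ℝ) θ => deriv F (z.1 + θ * (z.2 - z.1))) (by fun_prop) 0 1

lemma sub_eq_meanDeriv_mul {F : ℝ → ℝ} (hF : ContDiff ℝ 1 F) (a b : ℝ) :
    F b - F a = meanDeriv F a b * (b - a) := by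
  have hc := hF.continuous_deriv le_rfl
  have := intervalIntegral.integral_eq_sub_of_hasDerivAt (a := 0) (b := 1)
    (f := fun θ => F (a + θ * (b - a))) (f' := fun θ => deriv F (a + θ * (b - a)) * (b - a))
    (fun θ _ => by
      have h1 := (hF.differentiable one_ne_zero (a + θ * (b - a))).hasDerivAt
      have h2 : HasDerivAt (fun θ : ℝ => a + θ * (b - a)) (b - a) θ := by
        simpa using ((hasDerivAt_id θ).mul_const (b - a)).const_add a
      exact h1.comp θ h2)
    (Continuous.intervalIntegrable (by fun_prop) _ _)
  rw [intervalIntegral.integral_mul_const] at this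
  simpa [meanDeriv] using this.symm

lemma meanDeriv_self (F : ℝ → ℝ) (a : ℝ) : meanDeriv F a a = deriv F a := by
  simp [meanDeriv]

lemma abs_meanDeriv_le {F : ℝ → ℝ} {K : ℝ} (hK : ∀ x, |deriv F x| ≤ K) (a b : ℝ) :
    |meanDeriv F a b| ≤ K := by
  simpa [meanDeriv] using intervalIntegral.norm_integral_le_of_norm_le_const (a := 0) (b := 1)
    (f := fun θ => deriv F (a + θ * (b - a))) (C := K) (fun θ _ => hK _)

/-- The separation of two solutions of a scalar autonomous equation, in closed form. -/
lemma sub_eq_mul_exp_of_hasDerivAt_s2 {F : ℝ → ℝ} (hF : ContDiff ℝ 1 F) {α β : ℝ → ℝ}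
    (hα : ∀ t, HasDerivAt α (F (α t)) t) (hβ : ∀ t, HasDerivAt β (F (β t)) t) (t : ℝ) :
    β t - α t = (β 0 - α 0) * Real.exp (∫ s in (0 : ℝ)..t, meanDeriv F (α s) (β s)) := by
  have cα : Continuous α := continuous_iff_continuousAt.2 fun t => (hα t).continuousAt
  have cβ : Continuous β := continuous_iff_continuousAt.2 fun t => (hβ t).continuousAt
  have cw : Continuous fun s => meanDeriv F (α s) (β s) :=
    (continuous_meanDeriv hF).comp (cα.prodMk cβ)
  let I : ℝ → ℝ := fun t => ∫ s in (0 : ℝ)..t, meanDeriv F (α s) (β s)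
  have hI : ∀ t, HasDerivAt I (meanDeriv F (α t) (β t)) t := fun t =>
    intervalIntegral.integral_hasDerivAt_right (cw.intervalIntegrable _ _)
      cw.stronglyMeasurable.stronglyMeasurableAtFilter cw.continuousAt
  have hz : ∀ t, HasDerivAt (fun t => (β t - α t) * Real.exp (-I t)) 0 t := fun t => by
    have := ((hβ t).sub (hα t)).mul (hI t).neg.exp
    refine this.congr_deriv ?_
    rw [Pi.sub_apply, sub_eq_meanDeriv_mul hF]
    ring
  have := is_const_of_deriv_eq_zero (fun t => (hz t).differentiableAt) (fun t => (hz t).deriv) t 0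
  have hI0 : I 0 = 0 := intervalIntegral.integral_same
  simp only [hI0, neg_zero, Real.exp_zero, mul_one] at this
  rw [← this, mul_assoc, ← Real.exp_add]
  simp [I]

lemma exists_global_solution {F : ℝ → ℝ} (hF : ContDiff ℝ 1 F) {C K : ℝ}
    (hC : ∀ x, |F x| ≤ C) (hK : ∀ x, |deriv F x| ≤ K) (x : ℝ) :
    ∃ α : ℝ → ℝ, α 0 = x ∧ ∀ t, HasDerivAt α (F (α t)) t := by
  have hC0 : 0 ≤ C := (abs_nonneg _).trans (hC 0)
  have hK0 : 0 ≤ K := (abs_nonneg _).trans (hK 0)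
  have hL : LipschitzWith K.toNNReal F :=
    lipschitzWith_of_nnnorm_deriv_le (hF.differentiable one_ne_zero) fun x => by
      rw [← NNReal.coe_le_coe, coe_nnnorm, Real.coe_toNNReal _ hK0]; exact hK x
  have hloc : ∀ T : ℝ, ∃ α : ℝ → ℝ, α 0 = x ∧ ∀ t ∈ Ioo (-T) T, HasDerivAt α (F (α t)) t := by
    intro T
    rcases le_or_gt T 0 with hT | hT
    · exact ⟨fun _ => x, rfl, fun t ht => by have := ht.1.trans ht.2; linarith⟩
    have hPL : IsPicardLindelof (fun _ => F) (tmin := -T) (tmax := T)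
        ⟨0, by constructor <;> linarith⟩ x (C * T).toNNReal 0 C.toNNReal K.toNNReal := by
      refine IsPicardLindelof.of_time_independent (fun y _ => ?_) hL.lipschitzOnWith ?_
      · rw [Real.coe_toNNReal _ hC0]; exact hC y
      · rw [Real.coe_toNNReal _ hC0, Real.coe_toNNReal _ (by positivity)]; simp
    obtain ⟨α, h0, h⟩ := hPL.exists_eq_forall_mem_Icc_hasDerivWithinAt₀
    exact ⟨α, h0, fun t ht =>
      (h t (Ioo_subset_Icc_self ht)).hasDerivAt (Icc_mem_nhds ht.1 ht.2)⟩
  choose α h0 hα using hloc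
  have huniq : ∀ S T, S ≤ T → EqOn (α S) (α T) (Ioo (-S) S) := by
    intro S T hST t ht
    refine ODE_solution_unique_of_mem_Ioo (v := fun _ => F) (s := fun _ => univ) (t₀ := 0)
      (fun _ _ => hL.lipschitzOnWith) ?_ (fun s hs => ⟨hα S s hs, mem_univ _⟩)
      (fun s hs => ⟨hα T s ⟨by linarith [hs.1], by linarith [hs.2]⟩, mem_univ _⟩)
      ((h0 S).trans (h0 T).symm) ht
    constructor <;> linarith [ht.1, ht.2]
  have hmem : ∀ t : ℝ, t ∈ Ioo (-(|t| + 1)) (|t| + 1) := fun t =>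
    abs_lt.1 (lt_add_one |t|)
  refine ⟨fun t => α (|t| + 1) t, h0 _, fun t => ?_⟩
  have key : (fun s => α (|s| + 1) s) =ᶠ[𝓝 t] α (|t| + 2) := by
    have : ∀ᶠ s in 𝓝 t, |s| < |t| + 1 := continuous_abs.continuousAt.eventually_lt
      continuousAt_const (lt_add_one |t|)
    filter_upwards [this] with s hs
    exact huniq _ _ (by linarith) (hmem s)
  rw [key.hasDerivAt_iff]
  have := hα (|t| + 2) t ⟨by linarith [(hmem t).1], by linarith [(hmem t).2]⟩
  rwa [← huniq (|t| + 1) (|t| + 2) (by linarith) (hmem t)] at this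

/-- A smooth scalar autonomous equation with bounded, boundedly differentiable right hand side
has a global flow, which is jointly smooth. -/
theorem exists_contDiff_flow {F : ℝ → ℝ} (hF : ContDiff ℝ (⊤ : ℕ∞) F) {C K : ℝ}
    (hC : ∀ x, |F x| ≤ C) (hK : ∀ x, |deriv F x| ≤ K) :
    ∃ Q : ℝ → ℝ → ℝ, (∀ x, Q 0 x = x) ∧ (∀ t x, HasDerivAt (fun t => Q t x) (F (Q t x)) t) ∧
      (∀ s t x, Q (s + t) x = Q s (Q t x)) ∧
      ContDiff ℝ (⊤ : ℕ∞) (fun z : ℝ × ℝ => Q z.1 z.2) := by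
  have hF1 : ContDiff ℝ 1 F := hF.of_le (by exact_mod_cast le_top)
  choose α h0 hα using exists_global_solution hF1 hC hK
  let Q : ℝ → ℝ → ℝ := fun t x => α x t
  have hcQ : ∀ x, Continuous fun t => Q t x := fun x =>
    continuous_iff_continuousAt.2 fun t => (hα x t).continuousAt
  let A : ℝ → ℝ → ℝ → ℝ := fun x t y =>
    Real.exp (∫ s in (0 : ℝ)..t, meanDeriv F (Q s x) (Q s y))
  have hsub : ∀ x t y, Q t y - Q t x = (y - x) * A x t y := fun x t y => by
    have := sub_eq_mul_exp_of_hasDerivAt_s2 hF1 (hα x) (hα y) t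
    rwa [h0, h0] at this
  have hcont : Continuous (fun z : ℝ × ℝ => Q z.1 z.2) := by
    rw [continuous_iff_continuousAt]
    rintro ⟨t, x⟩
    have hb : ∀ z : ℝ × ℝ, ‖Q z.1 z.2 - Q z.1 x‖ ≤ |z.2 - x| * Real.exp (K * |z.1|) := by
      intro z
      rw [hsub, Real.norm_eq_abs, abs_mul, Real.abs_exp]
      gcongr
      refine (le_abs_self _).trans ?_
      simpa using intervalIntegral.norm_integral_le_of_norm_le_const (a := 0) (b := z.1)
        (C := K) (f := fun s => meanDeriv F (Q s x) (Q s z.2))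
        (fun s _ => abs_meanDeriv_le hK _ _)
    have h1 : Tendsto (fun z : ℝ × ℝ => Q z.1 z.2 - Q z.1 x) (𝓝 (t, x)) (𝓝 0) := by
      refine squeeze_zero_norm hb ?_
      have : Continuous fun z : ℝ × ℝ => |z.2 - x| * Real.exp (K * |z.1|) := by fun_prop
      simpa using this.tendsto (t, x)
    have h2 : Tendsto (fun z : ℝ × ℝ => Q z.1 x) (𝓝 (t, x)) (𝓝 (Q t x)) :=
      ((hcQ x).comp continuous_fst).tendsto (t, x)
    simpa [ContinuousAt] using h1.add h2
  have hQ : ∀ z : ℝ × ℝ, HasFDerivAt (fun z : ℝ × ℝ => Q z.1 z.2)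
      (F (Q z.1 z.2) • ContinuousLinearMap.fst ℝ ℝ ℝ +
        Real.exp (∫ s in (0 : ℝ)..z.1, deriv F (Q s z.2)) • ContinuousLinearMap.snd ℝ ℝ ℝ) z := by
    rintro ⟨t, x⟩
    have hA : Continuous (fun z : ℝ × ℝ => A x z.1 z.2) := by
      refine Real.continuous_exp.comp
        (intervalIntegral.continuous_parametric_intervalIntegral_of_continuous
          (f := fun (z : ℝ × ℝ) s => meanDeriv F (Q s x) (Q s z.2)) ?_ continuous_fst)
      have c1 : Continuous fun w : (ℝ × ℝ) × ℝ => Q w.2 x := (hcQ x).comp continuous_snd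
      have c2 : Continuous fun w : (ℝ × ℝ) × ℝ => Q w.2 w.1.2 :=
        hcont.comp (f := fun w : (ℝ × ℝ) × ℝ => (w.2, w.1.2)) (by fun_prop)
      exact (continuous_meanDeriv hF1).comp (c1.prodMk c2)
    have hAx : A x t x = Real.exp (∫ s in (0 : ℝ)..t, deriv F (Q s x)) := by
      simp [A, meanDeriv_self]
    have e : (fun z : ℝ × ℝ => Q z.1 z.2) = fun z => Q z.1 x + (z.2 - x) * A x z.1 z.2 := by
      ext z; rw [← hsub]; ring
    rw [e]
    refine HasFDerivAt.add ?_ ?_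
    · have := (hα x t).comp_hasFDerivAt (t, x) (hasFDerivAt_fst (𝕜 := ℝ) (p := (t, x)))
      exact this
    · refine .of_isLittleO ?_
      have ho := (Asymptotics.isBigO_refl (fun z : ℝ × ℝ => z.2 - x) (𝓝 (t, x))).mul_isLittleO
        ((Asymptotics.isLittleO_one_iff ℝ).2
          (tendsto_sub_nhds_zero_iff.2 (hA.tendsto (t, x))))
      have hO : (fun z : ℝ × ℝ => (z.2 - x) * 1) =O[𝓝 (t, x)] fun z => z - (t, x) :=
        .of_bound 1 (.of_forall fun z => by simpa using norm_snd_le (z - (t, x)))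
      refine (ho.trans_isBigO hO).congr_left fun z => ?_
      simp [← hAx]
      ring
  have hsm : ∀ n : ℕ, ContDiff ℝ n (fun z : ℝ × ℝ => Q z.1 z.2) := by
    intro n
    induction n with
    | zero => exact contDiff_zero.2 hcont
    | succ n ih =>
      push_cast
      rw [contDiff_succ_iff_hasFDerivAt]
      refine ⟨_, ?_, hQ⟩
      have hFn : ContDiff ℝ n F := hF.of_le (by exact_mod_cast le_top)
      have hFn' : ContDiff ℝ n (deriv F) :=
        ((contDiff_infty_iff_deriv.1 hF).2).of_le (by exact_mod_cast le_top)
      exact ((hFn.comp ih).smul contDiff_const).add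
        ((contDiff_parametric_primitive (g := fun s y => deriv F (Q s y))
          (hFn'.comp ih)).exp.smul contDiff_const)
  refine ⟨Q, h0, fun t x => hα x t, fun s t x => ?_, contDiff_infty.2 hsm⟩
  have h1 : ∀ s, HasDerivAt (fun s => Q (s + t) x) (F (Q (s + t) x)) s := fun s => by
    simpa using (hα x (s + t)).comp_add_const s t
  have := sub_eq_mul_exp_of_hasDerivAt_s2 hF1 h1 (hα (Q t x)) s
  simp only [h0, zero_add] at this
  have e : α (Q t x) s - Q (s + t) x = 0 := by rw [this]; simp [Q]
  exact (sub_eq_zero.1 e).symm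

/-- Rotation of the plane by the angle `t`. -/
noncomputable def planeRot (t : ℝ) (x : EuclideanSpace ℝ (Fin 2)) : EuclideanSpace ℝ (Fin 2) :=
  !₂[Real.cos t * x 0 - Real.sin t * x 1, Real.sin t * x 0 + Real.cos t * x 1]

lemma planeRot_zero (x : EuclideanSpace ℝ (Fin 2)) : planeRot 0 x = x := by
  ext i; fin_cases i <;> simp [planeRot]

lemma planeRot_add (s t : ℝ) (x : EuclideanSpace ℝ (Fin 2)) :
    planeRot (s + t) x = planeRot s (planeRot t x) := by
  ext i; fin_cases i <;> simp [planeRot, Real.cos_add, Real.sin_add] <;> ring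

lemma planeRot_smul (t c : ℝ) (x : EuclideanSpace ℝ (Fin 2)) :
    planeRot t (c • x) = c • planeRot t x := by
  ext i; fin_cases i <;> simp [planeRot] <;> ring

lemma planeRot_apply_zero (t : ℝ) : planeRot t 0 = 0 := by
  ext i; fin_cases i <;> simp [planeRot]

lemma planeRot_two_pi (x : EuclideanSpace ℝ (Fin 2)) : planeRot (2 * Real.pi) x = x := by
  ext i; fin_cases i <;> simp [planeRot]

lemma norm_planeRot (t : ℝ) (x : EuclideanSpace ℝ (Fin 2)) : ‖planeRot t x‖ = ‖x‖ := by
  simp only [EuclideanSpace.norm_eq, Fin.sum_univ_two, planeRot, Real.norm_eq_abs, sq_abs]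
  congr 1
  simp
  linear_combination (x 0 ^ 2 + x 1 ^ 2) * Real.sin_sq_add_cos_sq t

lemma contDiff_planeRot : ContDiff ℝ (⊤ : ℕ∞)
    (fun p : ℝ × EuclideanSpace ℝ (Fin 2) => planeRot p.1 p.2) := by
  have h (i : Fin 2) : ContDiff ℝ (⊤ : ℕ∞) (fun p : ℝ × EuclideanSpace ℝ (Fin 2) => p.2 i) :=
    contDiff_euclidean.1 contDiff_snd i
  have hc : ContDiff ℝ (⊤ : ℕ∞) (fun p : ℝ × EuclideanSpace ℝ (Fin 2) => Real.cos p.1) :=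
    Real.contDiff_cos.comp contDiff_fst
  have hs : ContDiff ℝ (⊤ : ℕ∞) (fun p : ℝ × EuclideanSpace ℝ (Fin 2) => Real.sin p.1) :=
    Real.contDiff_sin.comp contDiff_fst
  rw [contDiff_euclidean]
  intro i
  fin_cases i
  · simpa [planeRot] using (hc.mul (h 0)).sub (hs.mul (h 1))
  · simpa [planeRot] using (hs.mul (h 0)).add (hc.mul (h 1))

lemma norm_sq_plane (x : EuclideanSpace ℝ (Fin 2)) : ‖x‖ ^ 2 = x 0 ^ 2 + x 1 ^ 2 := by
  simp [EuclideanSpace.norm_sq_eq, Fin.sum_univ_two]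

lemma exists_planeRot_eq {x y : EuclideanSpace ℝ (Fin 2)} (h : ‖y‖ = ‖x‖) :
    ∃ t, planeRot t x = y := by
  rcases eq_or_ne x 0 with rfl | hx
  · exact ⟨0, by rw [planeRot_zero, eq_comm, ← norm_eq_zero, h, norm_zero]⟩
  have hr : x 0 ^ 2 + x 1 ^ 2 ≠ 0 := by
    rw [← norm_sq_plane]; exact pow_ne_zero 2 (norm_ne_zero_iff.2 hx)
  have hy : y 0 ^ 2 + y 1 ^ 2 = x 0 ^ 2 + x 1 ^ 2 := by
    rw [← norm_sq_plane, ← norm_sq_plane, h]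
  let z : ℂ := ⟨(x 0 * y 0 + x 1 * y 1) / (x 0 ^ 2 + x 1 ^ 2),
    (x 0 * y 1 - x 1 * y 0) / (x 0 ^ 2 + x 1 ^ 2)⟩
  have hz : ‖z‖ = 1 := by
    rw [← sq_eq_sq₀ (norm_nonneg _) zero_le_one, Complex.sq_norm, Complex.normSq_apply]
    simp only [z]
    field_simp
    linear_combination (x 0 ^ 2 + x 1 ^ 2) * hy
  have hz0 : z ≠ 0 := norm_ne_zero_iff.1 (by rw [hz]; exact one_ne_zero)
  refine ⟨z.arg, ?_⟩
  have hc := Complex.cos_arg hz0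
  have hs := Complex.sin_arg z
  rw [hz, div_one] at hc hs
  ext i
  fin_cases i
  · simp only [planeRot, hc, hs, z]
    simp
    field_simp
    ring
  · simp only [planeRot, hc, hs, z]
    simp
    field_simp
    ring

lemma two_pi_le_of_planeRot_eq {x : EuclideanSpace ℝ (Fin 2)} (hx : x ≠ 0) {s : ℝ} (hs : 0 < s)
    (h : planeRot s x = x) : 2 * Real.pi ≤ s := by
  have hr : x 0 ^ 2 + x 1 ^ 2 ≠ 0 := by
    rw [← norm_sq_plane]; exact pow_ne_zero 2 (norm_ne_zero_iff.2 hx)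
  have h0 : Real.cos s * x 0 - Real.sin s * x 1 = x 0 := by
    simpa [planeRot] using congrArg (fun y : EuclideanSpace ℝ (Fin 2) => y 0) h
  have h1 : Real.sin s * x 0 + Real.cos s * x 1 = x 1 := by
    simpa [planeRot] using congrArg (fun y : EuclideanSpace ℝ (Fin 2) => y 1) h
  have hc : Real.cos s = 1 := by
    apply mul_right_cancel₀ hr
    linear_combination x 0 * h0 + x 1 * h1
  obtain ⟨k, hk⟩ := (Real.cos_eq_one_iff s).1 hc
  have hk0 : 0 < (k : ℝ) := by
    by_contra hcon
    nlinarith [Real.pi_pos]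
  have hk1 : (1 : ℝ) ≤ k := by exact_mod_cast Int.cast_pos.1 hk0
  nlinarith [Real.pi_pos]

/-- A smooth compactly supported radial expansion rate, combined with the unit speed rotation,
generates a smooth flow of the plane. -/
theorem exists_spiral_flow {v : ℝ → ℝ} (hv : ContDiff ℝ (⊤ : ℕ∞) v) (hv0 : ∀ q, 0 ≤ v q)
    (hvc : HasCompactSupport v) :
    ∃ Φ : ℝ → EuclideanSpace ℝ (Fin 2) → EuclideanSpace ℝ (Fin 2), IsFlow Φ ∧
      ContDiff ℝ (⊤ : ℕ∞) (fun p : ℝ × EuclideanSpace ℝ (Fin 2) => Φ p.1 p.2) ∧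
      (∀ t x, v (‖x‖ ^ 2) = 0 → Φ t x = planeRot t x) ∧
      (∀ t x, x ≠ 0 → v (‖x‖ ^ 2) ≠ 0 → 0 < t → ‖x‖ < ‖Φ t x‖) ∧
      ∀ d : ℝ → ℝ, Differentiable ℝ d → (∀ q, deriv d q * v q = 0) →
        ∀ t x, d (‖Φ t x‖ ^ 2) = d (‖x‖ ^ 2) := by
  let F : ℝ → ℝ := fun q => 2 * q * v q
  have hF : ContDiff ℝ (⊤ : ℕ∞) F := (contDiff_const.mul contDiff_id).mul hv
  have hF1 : ContDiff ℝ 1 F := hF.of_le (by exact_mod_cast le_top)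
  have hFc : HasCompactSupport F := hvc.mul_left
  obtain ⟨C, hC⟩ := hFc.exists_bound_of_continuous hF.continuous
  obtain ⟨K, hK⟩ := hFc.deriv.exists_bound_of_continuous (hF1.continuous_deriv le_rfl)
  obtain ⟨Q, Q0, hQ, Qadd, Qsm⟩ := exists_contDiff_flow hF hC hK
  have hQc : ∀ q, Continuous fun t => Q t q := fun q =>
    continuous_iff_continuousAt.2 fun t => (hQ t q).continuousAt
  have hvQc : ∀ q, Continuous fun t => v (Q t q) := fun q => hv.continuous.comp (hQc q)
  let I : ℝ → ℝ → ℝ := fun t q => ∫ s in (0 : ℝ)..t, v (Q s q)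
  have hI : ∀ t q, HasDerivAt (fun t => I t q) (v (Q t q)) t := fun t q =>
    intervalIntegral.integral_hasDerivAt_right ((hvQc q).intervalIntegrable _ _)
      (hvQc q).stronglyMeasurable.stronglyMeasurableAtFilter (hvQc q).continuousAt
  have hI0 : ∀ q, I 0 q = 0 := fun q => intervalIntegral.integral_same
  have hIadd : ∀ s t q, I (s + t) q = I s (Q t q) + I t q := by
    intro s t q
    have h1 : (∫ r in (0 : ℝ)..s, v (Q r (Q t q))) = ∫ r in t..(s + t), v (Q r q) := by
      simp_rw [← Qadd]
      rw [intervalIntegral.integral_comp_add_right (fun r => v (Q r q)), zero_add]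
    simp only [I]
    rw [h1]
    exact ((add_comm _ _).trans (intervalIntegral.integral_add_adjacent_intervals
      ((hvQc q).intervalIntegrable _ _) ((hvQc q).intervalIntegrable _ _))).symm
  have hIsm : ContDiff ℝ (⊤ : ℕ∞) (fun z : ℝ × ℝ => I z.1 z.2) :=
    contDiff_infty.2 fun n => contDiff_parametric_primitive (g := fun s q => v (Q s q))
      ((hv.comp Qsm).of_le (by exact_mod_cast le_top))
  have hQI : ∀ t q, Q t q = Real.exp (I t q) ^ 2 * q := by
    intro t q
    have hz : ∀ t, HasDerivAt (fun t => Real.exp (-2 * I t q) * Q t q) 0 t := fun t => by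
      refine ((((hI t q).const_mul (-2)).exp).mul (hQ t q)).congr_deriv ?_
      simp only [F]
      ring
    have := is_const_of_deriv_eq_zero (fun t => (hz t).differentiableAt)
      (fun t => (hz t).deriv) t 0
    simp only [hI0, mul_zero, Real.exp_zero, one_mul, Q0] at this
    calc Q t q = Real.exp (I t q) ^ 2 * (Real.exp (-2 * I t q) * Q t q) := by
          rw [← Real.exp_nat_mul, ← mul_assoc, ← Real.exp_add]
          simp
      _ = _ := by rw [this]
  have hfix : ∀ t q, v q = 0 → Q t q = q := by
    intro t q hq
    have hFq : F q = 0 := by simp [F, hq]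
    have := sub_eq_mul_exp_of_hasDerivAt_s2 hF1 (α := fun _ => q)
      (fun t => by rw [hFq]; exact hasDerivAt_const t q) (fun t => hQ t q) t
    rw [Q0, sub_self, zero_mul] at this
    exact sub_eq_zero.1 this
  have hpos : ∀ t q, v q ≠ 0 → 0 < v (Q t q) := by
    intro t q hq
    refine (hv0 _).lt_of_ne' fun h => hq ?_
    have h1 := hfix (-t) _ h
    rw [← Qadd, neg_add_cancel, Q0] at h1
    rwa [← h1] at h
  let Φ : ℝ → EuclideanSpace ℝ (Fin 2) → EuclideanSpace ℝ (Fin 2) :=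
    fun t x => Real.exp (I t (‖x‖ ^ 2)) • planeRot t x
  have hnorm : ∀ t x, ‖Φ t x‖ = Real.exp (I t (‖x‖ ^ 2)) * ‖x‖ := fun t x => by
    simp only [Φ]
    rw [norm_smul, norm_planeRot, Real.norm_eq_abs, Real.abs_exp]
  have hnormQ : ∀ t x, ‖Φ t x‖ ^ 2 = Q t (‖x‖ ^ 2) := fun t x => by
    rw [hnorm, hQI, mul_pow]
  have hsm : ContDiff ℝ (⊤ : ℕ∞) (fun p : ℝ × EuclideanSpace ℝ (Fin 2) => Φ p.1 p.2) := by
    have h1 : ContDiff ℝ (⊤ : ℕ∞)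
        (fun p : ℝ × EuclideanSpace ℝ (Fin 2) => (p.1, ‖p.2‖ ^ 2)) :=
      contDiff_fst.prodMk (contDiff_snd.norm_sq ℝ)
    exact ((hIsm.comp h1).exp).smul contDiff_planeRot
  refine ⟨Φ, ⟨hsm.continuous, fun x => ?_, fun s t x => ?_⟩, hsm, fun t x hx => ?_,
    fun t x hx hvx ht => ?_, fun d hd hdv t x => ?_⟩
  · simp [Φ, hI0, planeRot_zero]
  · change Real.exp (I (s + t) (‖x‖ ^ 2)) • planeRot (s + t) x =
      Real.exp (I s (‖Φ t x‖ ^ 2)) • planeRot s (Φ t x)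
    rw [hnormQ]
    simp only [Φ]
    rw [hIadd, Real.exp_add, planeRot_add, planeRot_smul, smul_smul]
  · have : I t (‖x‖ ^ 2) = 0 := by simp [I, hfix _ _ hx, hx]
    simp [Φ, this]
  · rw [hnorm]
    have h1 : 0 < I t (‖x‖ ^ 2) :=
      intervalIntegral.intervalIntegral_pos_of_pos ((hvQc _).intervalIntegrable _ _)
        (fun s => hpos s _ hvx) ht
    exact lt_mul_of_one_lt_left (norm_pos_iff.2 hx) (Real.one_lt_exp_iff.2 h1)
  · rw [hnormQ]
    have hz : ∀ t, HasDerivAt (fun t => d (Q t (‖x‖ ^ 2))) 0 t := fun t => by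
      refine ((hd _).hasDerivAt.comp t (hQ t (‖x‖ ^ 2))).congr_deriv ?_
      simp only [F]
      linear_combination 2 * Q t (‖x‖ ^ 2) * hdv (Q t (‖x‖ ^ 2))
    have := is_const_of_deriv_eq_zero (fun t => (hz t).differentiableAt)
      (fun t => (hz t).deriv) t 0
    simpa only [Q0] using this

lemma flowOrbit_zero_mem {M : Type*} [TopologicalSpace M] {Φ : ℝ → M → M} (hΦ : IsFlow Φ) (x : M) :
    x ∈ flowOrbit Φ x := ⟨0, hΦ.2.1 x⟩

/-- Slowing down a flow by an invariant function gives a flow. -/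
lemma IsFlow.timeChange {M : Type*} [TopologicalSpace M] {Φ : ℝ → M → M} (hΦ : IsFlow Φ)
    {D : M → ℝ} (hD : Continuous D) (hinv : ∀ t x, D (Φ t x) = D x) :
    IsFlow (fun t x => Φ (t * D x) x) := by
  refine ⟨?_, fun x => by simp [hΦ.2.1], fun s t x => ?_⟩
  · exact hΦ.1.comp (f := fun p : ℝ × M => (p.1 * D p.2, p.2)) (by fun_prop)
  · simp only [hinv]
    rw [add_mul, hΦ.2.2]

lemma flowOrbit_timeChange {M : Type*} {Φ : ℝ → M → M} {D : M → ℝ}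
    (hD : ∀ x, 0 < D x ∨ ∀ t, Φ t x = x) (x : M) :
    flowOrbit (fun t x => Φ (t * D x) x) x = flowOrbit Φ x := by
  ext y
  rcases hD x with h | h
  · constructor
    · rintro ⟨t, ht⟩
      exact ⟨t * D x, ht⟩
    · rintro ⟨t, ht⟩
      exact ⟨t / D x, by simpa only [div_mul_cancel₀ _ h.ne'] using ht⟩
  · simp [flowOrbit, h]

lemma forwardOrbit_timeChange {M : Type*} {Φ : ℝ → M → M} {D : M → ℝ}
    (hD : ∀ x, 0 < D x ∨ ∀ t, Φ t x = x) (x : M) :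
    {y | ∃ t : ℝ, 0 ≤ t ∧ Φ (t * D x) x = y} = {y | ∃ t : ℝ, 0 ≤ t ∧ Φ t x = y} := by
  ext y
  rcases hD x with h | h
  · constructor
    · rintro ⟨t, h0, ht⟩
      exact ⟨t * D x, by positivity, ht⟩
    · rintro ⟨t, h0, ht⟩
      exact ⟨t / D x, by positivity, by simpa only [div_mul_cancel₀ _ h.ne'] using ht⟩
  · simp [h]

lemma isFlowPeriodicPt_timeChange {M : Type*} {Φ : ℝ → M → M} {D : M → ℝ}
    (hD : ∀ x, 0 < D x ∨ ∀ t, Φ t x = x) (x : M) :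
    IsFlowPeriodicPt (fun t x => Φ (t * D x) x) x ↔ IsFlowPeriodicPt Φ x := by
  rcases hD x with h | h
  · constructor
    · rintro ⟨t, h0, ht⟩
      exact ⟨t * D x, by positivity, ht⟩
    · rintro ⟨t, h0, ht⟩
      exact ⟨t / D x, by positivity, by simpa only [div_mul_cancel₀ _ h.ne'] using ht⟩
  · simp [IsFlowPeriodicPt, h]

/-- In the coordinate `p = 1 / |x| ^ 2`, the set of radii along which the flow expands. -/
def spiralSet : Set ℝ :=
  {p | 1 < p ∧ 0 < Real.sin (Real.pi * p) ∧ Real.cos (Real.pi * p) ≠ 0}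

lemma isOpen_spiralSet : IsOpen spiralSet := by
  have hs : Continuous fun p => Real.sin (Real.pi * p) := by fun_prop
  have hc : Continuous fun p => Real.cos (Real.pi * p) := by fun_prop
  exact isOpen_Ioi.inter ((isOpen_lt continuous_const hs).inter
    (isOpen_ne_fun hc continuous_const))

lemma isOpen_pos_inv_mem {s : Set ℝ} (hs : IsOpen s) : IsOpen {q : ℝ | 0 < q ∧ q⁻¹ ∈ s} :=
  ContinuousOn.isOpen_inter_preimage (s := Ioi 0)
    (fun _ hq => (continuousAt_inv₀ (ne_of_gt hq)).continuousWithinAt) isOpen_Ioi hs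

/-- The isolated points of the complement of `spiralSet` are half-integers. -/
lemma eq_add_half_of_isolated {p : ℝ} (hp : p ∉ spiralSet)
    (h : ∀ᶠ r in 𝓝 p, r ∉ spiralSet → r = p) : 1 < p ∧ ∃ n : ℕ, p = n + 1 / 2 := by
  obtain ⟨ε, hε, hball⟩ := Metric.eventually_nhds_iff.1 h
  obtain ⟨δ, hδ0, hδ⟩ := exists_between (lt_min hε (show (0 : ℝ) < 1 / 2 by norm_num))
  have hδε := hδ.trans_le (min_le_left _ _)
  have hδ2 := hδ.trans_le (min_le_right _ _)
  have h1 : p + δ ∈ spiralSet := by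
    by_contra hcon
    have := hball (by simpa [abs_of_pos hδ0]) hcon
    linarith
  have h2 : p - δ ∈ spiralSet := by
    by_contra hcon
    have := hball (by simpa [Real.dist_eq, abs_of_pos hδ0]) hcon
    linarith
  have hp1 : 1 < p := by linarith [h2.1]
  have hsin : 0 < Real.sin (Real.pi * p) := by
    have e1 := h1.2.1
    have e2 := h2.2.1
    rw [mul_add, Real.sin_add] at e1
    rw [mul_sub, Real.sin_sub] at e2
    have hcos : 0 < Real.cos (Real.pi * δ) := by
      apply Real.cos_pos_of_mem_Ioo
      constructor <;> nlinarith [Real.pi_pos]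
    have : 0 < Real.sin (Real.pi * p) * Real.cos (Real.pi * δ) := by linarith
    exact (pos_iff_pos_of_mul_pos this).2 hcos
  have hcos : Real.cos (Real.pi * p) = 0 := by
    by_contra hcon
    exact hp ⟨hp1, hsin, hcon⟩
  obtain ⟨k, hk⟩ := Real.cos_eq_zero_iff.1 hcos
  have hpk : p = k + 1 / 2 := by
    apply mul_left_cancel₀ Real.pi_ne_zero
    rw [hk]; ring
  have hk0 : 0 ≤ k := by
    have : (-1 : ℝ) < k := by linarith
    have : -1 < k := by exact_mod_cast this
    omega
  lift k to ℕ using hk0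
  exact ⟨hp1, k, by simpa using hpk⟩

/-- Odd-numbered half-integers are isolated points of the complement of `spiralSet`. -/
lemma eq_of_notMem_spiralSet (n : ℕ) {r : ℝ} (hr : |r - (2 * (n + 1) + 1 / 2)| < 1 / 2)
    (hrs : r ∉ spiralSet) : r = 2 * (n + 1) + 1 / 2 := by
  have e : Real.pi * r = Real.pi * (r - (2 * (n + 1) + 1 / 2)) + Real.pi / 2 +
      (n + 1 : ℕ) * (2 * Real.pi) := by push_cast; ring
  obtain ⟨h1, h2⟩ := abs_lt.1 hr
  have hpi := Real.pi_pos
  have hsin : 0 < Real.sin (Real.pi * r) := by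
    rw [e, Real.sin_add_nat_mul_two_pi, Real.sin_add_pi_div_two]
    apply Real.cos_pos_of_mem_Ioo
    constructor <;> nlinarith
  have hr1 : 1 < r := by
    have : (0 : ℝ) ≤ n := n.cast_nonneg
    linarith
  have hcos : Real.cos (Real.pi * r) = 0 := by
    by_contra hcon
    exact hrs ⟨hr1, hsin, hcon⟩
  rw [e, Real.cos_add_nat_mul_two_pi, Real.cos_add_pi_div_two, neg_eq_zero] at hcos
  have := (Real.sin_eq_zero_iff_of_lt_of_lt (by nlinarith) (by nlinarith)).1 hcos
  rcases mul_eq_zero.1 this with h | h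
  · exact absurd h hpi.ne'
  · linarith

lemma notMem_spiralSet (n : ℕ) : 2 * ((n : ℝ) + 1) + 1 / 2 ∉ spiralSet := by
  intro h
  apply h.2.2
  have e : Real.pi * (2 * ((n : ℝ) + 1) + 1 / 2) =
      Real.pi / 2 + (n + 1 : ℕ) * (2 * Real.pi) := by push_cast; ring
  rw [e, Real.cos_add_nat_mul_two_pi, Real.cos_pi_div_two]

/-- There are a smooth rate `v`, supported where `1 / q ∈ spiralSet`, and a smooth clock `d`,
constant on the intervals where `v` does not vanish and positive for `q > 0`. -/
lemma exists_rate_and_clock : ∃ v d : ℝ → ℝ,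
    ContDiff ℝ (⊤ : ℕ∞) v ∧ (∀ q, 0 ≤ v q) ∧ HasCompactSupport v ∧ v 0 = 0 ∧
    (∀ q, 0 < q → (v q = 0 ↔ q⁻¹ ∉ spiralSet)) ∧
    ContDiff ℝ (⊤ : ℕ∞) d ∧ (∀ q, deriv d q * v q = 0) ∧ (∀ q, 0 < q → 0 < d q) ∧
    (∀ q, 0 ≤ q → d q ≤ q) := by
  obtain ⟨v, hvs, hv, hvr⟩ := (isOpen_pos_inv_mem isOpen_spiralSet).exists_contDiff_support_eq
    (n := ⊤)
  have hN : IsOpen {p : ℝ | Real.sin (Real.pi * p) < 0} :=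
    isOpen_lt (by fun_prop) continuous_const
  obtain ⟨f, hfs, hf, hfr⟩ := (isOpen_pos_inv_mem hN).exists_contDiff_support_eq (n := ⊤)
  have hv_iff : ∀ q, v q ≠ 0 ↔ 0 < q ∧ q⁻¹ ∈ spiralSet := fun q => by
    rw [← Function.mem_support, hvs]; rfl
  have hf_iff : ∀ q, f q ≠ 0 ↔ 0 < q ∧ Real.sin (Real.pi * q⁻¹) < 0 := fun q => by
    rw [← Function.mem_support, hfs]; rfl
  have hf0 : ∀ q, 0 ≤ f q := fun q => (hfr ⟨q, rfl⟩).1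
  have hfc := hf.continuous
  have hd : ∀ q, HasDerivAt (fun q => ∫ s in (0 : ℝ)..q, f s) (f q) q := fun q =>
    intervalIntegral.integral_hasDerivAt_right (hfc.intervalIntegrable _ _)
      hfc.stronglyMeasurable.stronglyMeasurableAtFilter hfc.continuousAt
  have hderiv : deriv (fun q => ∫ s in (0 : ℝ)..q, f s) = f := funext fun q => (hd q).deriv
  refine ⟨v, fun q => ∫ s in (0 : ℝ)..q, f s, hv, fun q => (hvr ⟨q, rfl⟩).1, ?_, ?_,
    fun q hq => ?_, ?_, fun q => ?_, fun q hq => ?_, fun q hq => ?_⟩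
  · refine HasCompactSupport.of_support_subset_isCompact (isCompact_Icc (a := (0 : ℝ)) (b := 1)) ?_
    intro q hq
    obtain ⟨h0, h1⟩ := (hv_iff q).1 hq
    exact ⟨h0.le, by simpa using inv_le_one_of_one_le₀ h1.1.le⟩
  · by_contra h
    exact lt_irrefl _ ((hv_iff 0).1 h).1
  · rw [← not_iff_not, not_not]
    simpa [hq] using hv_iff q
  · rw [contDiff_infty_iff_deriv, hderiv]
    exact ⟨fun q => (hd q).differentiableAt, hf⟩
  · rw [hderiv]
    by_contra h
    obtain ⟨h1, h2⟩ := mul_ne_zero_iff.1 h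
    exact lt_asymm ((hf_iff q).1 h1).2 ((hv_iff q).1 h2).2.2.1
  · obtain ⟨n, hn⟩ := exists_nat_gt q⁻¹
    have hn' : 0 < (n : ℝ) := (inv_pos.2 hq).trans hn
    have hlt : q⁻¹ < 2 * n + 3 / 2 := by linarith
    refine intervalIntegral.integral_pos hq hfc.continuousOn (fun x _ => hf0 x)
      ⟨(2 * n + 3 / 2)⁻¹, ⟨by positivity, ?_⟩, (hf0 _).lt_of_ne' ((hf_iff _).2 ⟨by positivity, ?_⟩)⟩
    · exact (inv_lt_of_inv_lt₀ hq hlt).le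
    · have e : Real.pi * (2 * (n : ℝ) + 3 / 2)⁻¹⁻¹ =
          Real.pi / 2 + Real.pi + n * (2 * Real.pi) := by rw [inv_inv]; ring
      rw [e, Real.sin_add_nat_mul_two_pi, Real.sin_add_pi, Real.sin_pi_div_two]
      norm_num
  · have := intervalIntegral.integral_mono_on (g := fun _ => (1 : ℝ)) hq
      (hfc.intervalIntegrable _ _) (intervalIntegrable_const (μ := MeasureTheory.volume)) fun s _ => (hfr ⟨s, rfl⟩).2
    simpa using this

/-- The orbit of `x` has a neighbourhood containing no further periodic points. -/
def IsIsolatedOrbit {M : Type*} [TopologicalSpace M] (φ : ℝ → M → M) (x : M) : Prop :=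
  ∃ U : Set M, IsOpen U ∧ flowOrbit φ x ⊆ U ∧
    ∀ y ∈ U, IsFlowPeriodicPt φ y → y ∈ flowOrbit φ x

lemma flowOrbit_eq_sphere_of_planeRot
    {Φ : ℝ → EuclideanSpace ℝ (Fin 2) → EuclideanSpace ℝ (Fin 2)}
    {x : EuclideanSpace ℝ (Fin 2)} (h : ∀ t, Φ t x = planeRot t x) :
    flowOrbit Φ x = Metric.sphere 0 ‖x‖ := by
  ext y
  rw [mem_sphere_zero_iff_norm]
  constructor
  · rintro ⟨t, rfl⟩
    rw [h, norm_planeRot]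
  · intro hy
    obtain ⟨t, ht⟩ := exists_planeRot_eq hy
    exact ⟨t, (h t).trans ht⟩

lemma half_integer_of_isIsolatedOrbit {v : ℝ → ℝ}
    (hvW : ∀ q, 0 < q → (v q = 0 ↔ q⁻¹ ∉ spiralSet))
    {Φ : ℝ → EuclideanSpace ℝ (Fin 2) → EuclideanSpace ℝ (Fin 2)} (hΦ : IsFlow Φ)
    (hper : ∀ x, IsFlowPeriodicPt Φ x ↔ v (‖x‖ ^ 2) = 0)
    (horb : ∀ x, v (‖x‖ ^ 2) = 0 → flowOrbit Φ x = Metric.sphere 0 ‖x‖)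
    {x : EuclideanSpace ℝ (Fin 2)} (hx : x ≠ 0) (hp : IsFlowPeriodicPt Φ x)
    (hi : IsIsolatedOrbit Φ x) :
    1 < (‖x‖ ^ 2)⁻¹ ∧ ∃ n : ℕ, (‖x‖ ^ 2)⁻¹ = n + 1 / 2 := by
  have hn : 0 < ‖x‖ := norm_pos_iff.2 hx
  have hq : 0 < ‖x‖ ^ 2 := by positivity
  have hv := (hper x).1 hp
  obtain ⟨U, hU, hxU, hiU⟩ := hi
  refine eq_add_half_of_isolated ((hvW _ hq).1 hv) ?_
  let g : ℝ → EuclideanSpace ℝ (Fin 2) := fun r => (√(r⁻¹) / ‖x‖) • x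
  have hg : ∀ r, 0 < r → ‖g r‖ ^ 2 = r⁻¹ := fun r hr => by
    simp only [g]
    rw [norm_smul, Real.norm_eq_abs, abs_of_nonneg (by positivity), div_mul_cancel₀ _ hn.ne',
      Real.sq_sqrt (by positivity)]
  have hgc : ContinuousAt g (‖x‖ ^ 2)⁻¹ := by
    have h1 : ContinuousAt (fun r : ℝ => r⁻¹) (‖x‖ ^ 2)⁻¹ := continuousAt_inv₀ (by positivity)
    exact ((Real.continuous_sqrt.continuousAt.comp h1).div_const _).smul continuousAt_const
  have hgx : g (‖x‖ ^ 2)⁻¹ = x := by simp [g, hn.ne']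
  have hgU : ∀ᶠ r in 𝓝 (‖x‖ ^ 2)⁻¹, g r ∈ U := by
    refine hgc.eventually (hU.mem_nhds ?_)
    rw [hgx]
    exact hxU (flowOrbit_zero_mem hΦ x)
  filter_upwards [hgU, lt_mem_nhds (inv_pos.2 hq)] with r hr hr0 hrs
  have h1 : v (‖g r‖ ^ 2) = 0 := by
    rw [hg r hr0, hvW _ (inv_pos.2 hr0), inv_inv]; exact hrs
  have h2 := hiU _ hr ((hper _).2 h1)
  rw [horb x hv, mem_sphere_zero_iff_norm] at h2
  rw [← h2, hg r hr0, inv_inv]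

/-- Infinitely many isolated circles are periodic orbits of a uniformly bounded period. -/
lemma EP_eq_top_of_rate {v : ℝ → ℝ}
    (hvW : ∀ q, 0 < q → (v q = 0 ↔ q⁻¹ ∉ spiralSet))
    {Φ : ℝ → EuclideanSpace ℝ (Fin 2) → EuclideanSpace ℝ (Fin 2)}
    (hper : ∀ x, IsFlowPeriodicPt Φ x ↔ v (‖x‖ ^ 2) = 0)
    (hrot : ∀ t x, v (‖x‖ ^ 2) = 0 → Φ t x = planeRot t x) : EP Φ = ⊤ := by
  have horb : ∀ x, v (‖x‖ ^ 2) = 0 → flowOrbit Φ x = Metric.sphere 0 ‖x‖ := fun x hx =>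
    flowOrbit_eq_sphere_of_planeRot fun t => hrot t x hx
  let p : ℕ → ℝ := fun n => 2 * (n + 1) + 1 / 2
  have hp : ∀ n, 0 < p n := fun n => by positivity
  let x : ℕ → EuclideanSpace ℝ (Fin 2) := fun n => EuclideanSpace.single 0 √(p n)⁻¹
  have hxn : ∀ n, ‖x n‖ = √(p n)⁻¹ := fun n => by simp [x]
  have hx : ∀ n, ‖x n‖ ^ 2 = (p n)⁻¹ := fun n => by
    rw [hxn, Real.sq_sqrt (inv_pos.2 (hp n)).le]
  have hv : ∀ n, v (‖x n‖ ^ 2) = 0 := fun n => by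
    rw [hx, hvW _ (inv_pos.2 (hp n)), inv_inv]
    exact notMem_spiralSet n
  have hmem : ∀ t, 2 * Real.pi ≤ t → ∀ n, Metric.sphere 0 ‖x n‖ ∈ periodicOrbits Φ t := by
    intro t ht n
    refine ⟨x n, (horb _ (hv n)).symm, ⟨2 * Real.pi, by positivity, ht, ?_⟩,
      {y | 0 < ‖y‖ ^ 2 ∧ (‖y‖ ^ 2)⁻¹ ∈ Metric.ball (p n) (1 / 2)}, ?_, ?_, ?_⟩
    · rw [hrot _ _ (hv n), planeRot_two_pi]
    · have hc : Continuous fun y : EuclideanSpace ℝ (Fin 2) => ‖y‖ ^ 2 := by fun_prop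
      exact (isOpen_pos_inv_mem Metric.isOpen_ball).preimage hc
    · rw [horb _ (hv n)]
      intro y hy
      rw [mem_sphere_zero_iff_norm] at hy
      change 0 < ‖y‖ ^ 2 ∧ (‖y‖ ^ 2)⁻¹ ∈ Metric.ball (p n) (1 / 2)
      rw [hy, hx, inv_inv]
      exact ⟨inv_pos.2 (hp n), Metric.mem_ball_self (by norm_num)⟩
    · rintro y ⟨hy0, hy⟩ hyp
      have h1 := (hvW _ hy0).1 ((hper y).1 hyp)
      have h2 : (‖y‖ ^ 2)⁻¹ = p n := eq_of_notMem_spiralSet n (by simpa [Real.dist_eq, p] using hy) h1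
      rw [horb _ (hv n), mem_sphere_zero_iff_norm, ← sq_eq_sq₀ (norm_nonneg _) (norm_nonneg _), hx,
        ← h2, inv_inv]
  have hinj : Function.Injective
      fun n => Metric.sphere (0 : EuclideanSpace ℝ (Fin 2)) ‖x n‖ := by
    intro a b hab
    simp only at hab
    have h1 : x a ∈ Metric.sphere (0 : EuclideanSpace ℝ (Fin 2)) ‖x b‖ := by
      rw [← hab]; simp
    rw [mem_sphere_zero_iff_norm] at h1
    have h2 : p a = p b := by rw [← inv_inj, ← hx, ← hx, h1]
    simp only [p] at h2
    have h3 : (a : ℝ) = b := by linarith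
    exact_mod_cast h3
  have htop : ∀ᶠ t : ℝ in atTop,
      ENNReal.ofReal (1 / t) * elog (periodicOrbits Φ t).encard = ⊤ := by
    filter_upwards [eventually_ge_atTop (2 * Real.pi)] with t ht
    have ht0 : 0 < t := Real.two_pi_pos.trans_le ht
    have hinf := Set.infinite_of_injective_forall_mem hinj (hmem t ht)
    rw [hinf.encard_eq, elog, if_pos rfl, ENNReal.mul_top]
    simpa using ht0
  rw [EP, limsup_congr htop, limsup_const]

/-- At most linear growth of the number of periodic orbits gives zero exponential growth. -/
lemma EP_eq_zero_of_encard_le {M : Type*} [TopologicalSpace M] {φ : ℝ → M → M}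
    (h : ∀ t, 0 < t → (periodicOrbits φ t).encard ≤ (⌊t⌋₊ + 2 : ℕ)) : EP φ = 0 := by
  have hlim : Tendsto (fun t : ℝ => Real.log (t + 2) / t) atTop (𝓝 0) := by
    have h1 : Tendsto (fun s : ℝ => Real.log s / (1 * s + -2)) atTop (𝓝 0) := by
      simpa using Real.tendsto_pow_log_div_mul_add_atTop 1 (-2) 1 one_ne_zero
    have := h1.comp (tendsto_atTop_add_const_right atTop (2 : ℝ) tendsto_id)
    refine this.congr fun t => ?_
    simp
  have hlim' := ENNReal.tendsto_ofReal hlim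
  rw [ENNReal.ofReal_zero] at hlim'
  refine (tendsto_of_tendsto_of_tendsto_of_le_of_le' tendsto_const_nhds hlim'
    (.of_forall fun t => zero_le) ?_).limsup_eq
  filter_upwards [eventually_gt_atTop 0] with t ht
  have hle := h t ht
  have hne : (periodicOrbits φ t).encard ≠ ⊤ := ne_top_of_le_ne_top (ENat.natCast_ne_top _) hle
  rw [elog, if_neg hne, ← ENNReal.ofReal_mul (by positivity), one_div_mul_eq_div]
  have hnat : (periodicOrbits φ t).encard.toNat ≤ ⌊t⌋₊ + 2 := ENat.toNat_le_of_le_natCast hle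
  have hreal : ((periodicOrbits φ t).encard.toNat : ℝ) ≤ t + 2 := by
    have h1 : ((periodicOrbits φ t).encard.toNat : ℝ) ≤ ⌊t⌋₊ + 2 := by exact_mod_cast hnat
    linarith [Nat.floor_le ht.le]
  have hlog : Real.log (periodicOrbits φ t).encard.toNat ≤ Real.log (t + 2) := by
    rcases Nat.eq_zero_or_pos (periodicOrbits φ t).encard.toNat with h0 | h0
    · rw [h0, Nat.cast_zero, Real.log_zero]
      exact Real.log_nonneg (by linarith)
    · exact Real.log_le_log (by exact_mod_cast h0) hreal
  gcongr

/-- There exist two equivalent `C^∞` flows on the plane `ℝ²` with `EP = 0` and `EP = ∞`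
respectively, all of whose isolated periodic orbits are round circles centered at the
origin of radius at most `1`. -/
theorem exists_equivalent_smooth_flows_on_plane_EP_zero_and_infty :
    ∃ φ φ' : ℝ → EuclideanSpace ℝ (Fin 2) → EuclideanSpace ℝ (Fin 2),
      IsFlow φ ∧ IsFlow φ' ∧
      ContDiff ℝ (⊤ : ℕ∞) (fun p : ℝ × EuclideanSpace ℝ (Fin 2) => φ p.1 p.2) ∧
      ContDiff ℝ (⊤ : ℕ∞) (fun p : ℝ × EuclideanSpace ℝ (Fin 2) => φ' p.1 p.2) ∧
      FlowEquiv φ φ' ∧ EP φ = 0 ∧ EP φ' = ⊤ ∧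
      (∀ ψ ∈ ({φ, φ'} : Set (ℝ → EuclideanSpace ℝ (Fin 2) → EuclideanSpace ℝ (Fin 2))),
        ∀ x : EuclideanSpace ℝ (Fin 2), IsFlowPeriodicPt ψ x →
        (∃ U : Set (EuclideanSpace ℝ (Fin 2)), IsOpen U ∧ flowOrbit ψ x ⊆ U ∧
            ∀ y ∈ U, IsFlowPeriodicPt ψ y → y ∈ flowOrbit ψ x) →
        ∃ r : ℝ, 0 ≤ r ∧ r ≤ 1 ∧
          flowOrbit ψ x = Metric.sphere (0 : EuclideanSpace ℝ (Fin 2)) r) := by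
  obtain ⟨v, d, hv, hv0, hvc, hvz, hvW, hd, hdv, hdpos, hdle⟩ := exists_rate_and_clock
  obtain ⟨Φ, hΦ, hΦs, hrot, hgrow, hinv⟩ := exists_spiral_flow hv hv0 hvc
  let D : EuclideanSpace ℝ (Fin 2) → ℝ := fun x => d (‖x‖ ^ 2)
  have hDs : ContDiff ℝ (⊤ : ℕ∞) D := hd.comp (contDiff_id.norm_sq ℝ)
  have hDinv : ∀ t x, D (Φ t x) = D x := hinv d (hd.differentiable (by simp)) hdv
  have hD0 : ∀ x, x ≠ 0 → 0 < D x := fun x hx => hdpos _ (by positivity)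
  have hD : ∀ x, 0 < D x ∨ ∀ t, Φ t x = x := fun x => by
    rcases eq_or_ne x 0 with rfl | hx
    · exact Or.inr fun t => by rw [hrot t 0 (by simpa using hvz), planeRot_apply_zero]
    · exact Or.inl (hD0 x hx)
  have hper : ∀ x, IsFlowPeriodicPt Φ x ↔ v (‖x‖ ^ 2) = 0 := by
    intro x
    constructor
    · rintro ⟨s, hs, hsx⟩
      by_contra hvx
      have hx : x ≠ 0 := by
        rintro rfl
        exact hvx (by simpa using hvz)
      have := hgrow s x hx hvx hs
      rw [hsx] at this
      exact lt_irrefl _ this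
    · intro hvx
      exact ⟨2 * Real.pi, Real.two_pi_pos, by rw [hrot _ _ hvx, planeRot_two_pi]⟩
  have horb : ∀ x, v (‖x‖ ^ 2) = 0 → flowOrbit Φ x = Metric.sphere 0 ‖x‖ := fun x hx =>
    flowOrbit_eq_sphere_of_planeRot fun t => hrot t x hx
  let Ψ : ℝ → EuclideanSpace ℝ (Fin 2) → EuclideanSpace ℝ (Fin 2) := fun t x => Φ (t * D x) x
  have hΨ : IsFlow Ψ := hΦ.timeChange hDs.continuous hDinv
  have hΨorb : ∀ x, flowOrbit Ψ x = flowOrbit Φ x := flowOrbit_timeChange hD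
  have hΨper : ∀ x, IsFlowPeriodicPt Ψ x ↔ v (‖x‖ ^ 2) = 0 := fun x =>
    (isFlowPeriodicPt_timeChange hD x).trans (hper x)
  have hΨorb' : ∀ x, v (‖x‖ ^ 2) = 0 → flowOrbit Ψ x = Metric.sphere 0 ‖x‖ := fun x hx =>
    (hΨorb x).trans (horb x hx)
  have hround : ∀ ψ : ℝ → EuclideanSpace ℝ (Fin 2) → EuclideanSpace ℝ (Fin 2), IsFlow ψ →
      (∀ x, IsFlowPeriodicPt ψ x ↔ v (‖x‖ ^ 2) = 0) →
      (∀ x, v (‖x‖ ^ 2) = 0 → flowOrbit ψ x = Metric.sphere 0 ‖x‖) →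
      ∀ x, IsFlowPeriodicPt ψ x → IsIsolatedOrbit ψ x →
      ∃ r : ℝ, 0 ≤ r ∧ r ≤ 1 ∧
        flowOrbit ψ x = Metric.sphere (0 : EuclideanSpace ℝ (Fin 2)) r := by
    intro ψ hψ hp ho x hx hi
    refine ⟨‖x‖, norm_nonneg x, ?_, ho x ((hp x).1 hx)⟩
    rcases eq_or_ne x 0 with rfl | hx0
    · simp
    · have h1 := (half_integer_of_isIsolatedOrbit hvW hψ hp ho hx0 hx hi).1
      have h2 := (one_lt_inv₀ (by positivity)).1 h1
      nlinarith [norm_nonneg x]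
  refine ⟨Ψ, Φ, hΨ, hΦ, ?_, hΦs, ?_, ?_, EP_eq_top_of_rate hvW hper hrot, ?_⟩
  · exact hΦs.comp (f := fun p : ℝ × EuclideanSpace ℝ (Fin 2) => (p.1 * D p.2, p.2))
      ((contDiff_fst.mul (hDs.comp contDiff_snd)).prodMk contDiff_snd)
  · refine ⟨Homeomorph.refl _, fun x => ⟨?_, ?_⟩⟩
    · simpa using hΨorb x
    · simpa using forwardOrbit_timeChange hD x
  · refine EP_eq_zero_of_encard_le fun t ht => ?_
    let S : ℕ → Set (EuclideanSpace ℝ (Fin 2)) := fun n => Metric.sphere 0 √((n + 1 / 2 : ℝ)⁻¹)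
    have hsub : periodicOrbits Ψ t ⊆
        insert (Metric.sphere 0 0) (S '' (Finset.range (⌊t⌋₊ + 1) : Set ℕ)) := by
      rintro o ⟨x, rfl, ⟨s, hs0, hst, hsx⟩, hi⟩
      have hvx := (hΨper x).1 ⟨s, hs0, hsx⟩
      rw [hΨorb' x hvx]
      rcases eq_or_ne x 0 with rfl | hx0
      · left
        rw [norm_zero]
      right
      obtain ⟨-, n, hn⟩ := half_integer_of_isIsolatedOrbit hvW hΨ hΨper hΨorb' hx0
        ⟨s, hs0, hsx⟩ hi
      refine ⟨n, ?_, ?_⟩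
      · have hDx := hD0 x hx0
        have h1 : 2 * Real.pi ≤ s * D x := by
          refine two_pi_le_of_planeRot_eq hx0 (by positivity) ?_
          rw [← hrot _ _ hvx]
          exact hsx
        have h2 : D x ≤ ‖x‖ ^ 2 := hdle _ (by positivity)
        have hq : 0 < ‖x‖ ^ 2 := by positivity
        have h3 : 1 ≤ t * ‖x‖ ^ 2 := by
          have : s * D x ≤ t * ‖x‖ ^ 2 := by gcongr
          linarith [Real.pi_gt_three]
        have h4 : (‖x‖ ^ 2)⁻¹ ≤ t := (inv_le_iff_one_le_mul₀ hq).2 h3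
        have h5 : n ≤ ⌊t⌋₊ := Nat.le_floor (by linarith)
        simpa using Nat.lt_succ_of_le h5
      · simp only [S]
        rw [← hn, inv_inv, Real.sqrt_sq (norm_nonneg x)]
    calc (periodicOrbits Ψ t).encard
        ≤ (insert (Metric.sphere 0 0) (S '' (Finset.range (⌊t⌋₊ + 1) : Set ℕ))).encard :=
          Set.encard_le_encard hsub
      _ ≤ (S '' (Finset.range (⌊t⌋₊ + 1) : Set ℕ)).encard + 1 := Set.encard_insert_le _ _
      _ ≤ (Finset.range (⌊t⌋₊ + 1) : Set ℕ).encard + 1 := by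
          gcongr
          exact Set.encard_image_le _ _
      _ = (⌊t⌋₊ + 2 : ℕ) := by
          rw [Set.encard_coe_eq_coe_finsetCard, Finset.card_range]
          norm_cast
  · intro ψ hψ x hx hi
    rcases hψ with rfl | rfl
    · exact hround _ hΨ hΨper hΨorb' x hx hi
    · exact hround _ hΦ hper horb x hx hi
end

section
/- Let d ≥ 1 and let (β_i)_{i ≥ 0} be a strictly decreasing sequence of positive real numbers with β₀ = 1. Then there exists a C^∞ function w : ℝ^d → [0,1] such that: (1) for every x with ‖x‖ ≤ 2, w(x) = 0 if and only if x = 0; (2) for every integer i ≥ 1 and every x with ‖x‖ ≤ 1/(i+1), we have w(x) ≤ β_{i−1}; (3) w(x) = 1 whenever 1 ≤ ‖x‖ ≤ 2. -/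
open Set Filter Topology

/-- A compactly supported smooth function has all derivatives up to a given order
uniformly bounded. -/
theorem exists_bound_iteratedFDeriv_of_hasCompactSupport {E F : Type*} [NormedAddCommGroup E]
    [NormedSpace ℝ E] [NormedAddCommGroup F] [NormedSpace ℝ F] {f : E → F}
    (hf : ContDiff ℝ (⊤ : ℕ∞) f) (hc : HasCompactSupport f) (n : ℕ) :
    ∃ M : ℝ, 1 ≤ M ∧ ∀ k ≤ n, ∀ x, ‖iteratedFDeriv ℝ k f x‖ ≤ M := by
  have h : ∀ k : ℕ, ∃ C, ∀ x, ‖iteratedFDeriv ℝ k f x‖ ≤ C := fun k =>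
    (hc.iteratedFDeriv k).exists_bound_of_continuous
      (hf.continuous_iteratedFDeriv (by exact_mod_cast le_top))
  choose C hC using h
  refine ⟨1 + ∑ k ∈ Finset.range (n + 1), |C k|, ?_, fun k hk x => ?_⟩
  · exact le_add_of_nonneg_right (Finset.sum_nonneg fun _ _ => abs_nonneg _)
  · have h₁ : |C k| ≤ ∑ k ∈ Finset.range (n + 1), |C k| :=
      Finset.single_le_sum (f := fun k => |C k|) (fun _ _ => abs_nonneg _)
        (Finset.mem_range.2 (Nat.lt_succ_of_le hk))
    linarith [hC k x, le_abs_self (C k)]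

/-- On a finite-dimensional space there is a smooth `[0,1]`-valued function which is positive on
a punctured ball, vanishes at `0`, and is bounded by a prescribed positive decreasing sequence
on the balls of radius `1 / (i + 1)`. -/
theorem exists_contDiff_pos_on_punctured_ball_le {E : Type*} [NormedAddCommGroup E]
    [NormedSpace ℝ E] [FiniteDimensional ℝ E] (R : ℝ) {b : ℕ → ℝ} (hpos : ∀ i, 0 < b i)
    (hanti : Antitone b) :
    ∃ g : E → ℝ, ContDiff ℝ (⊤ : ℕ∞) g ∧ (∀ x, 0 ≤ g x) ∧ (∀ x, g x ≤ b 0) ∧ g 0 = 0 ∧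
      (∀ x, x ≠ 0 → ‖x‖ < R → 0 < g x) ∧
      ∀ (i : ℕ) (x : E), ‖x‖ ≤ 1 / (i + 1) → g x ≤ b i := by
  have hex : ∀ j : ℕ, ∃ f : E → ℝ,
      Function.support f = Metric.ball 0 R \ Metric.closedBall 0 (1 / ((j : ℝ) + 1)) ∧
        ContDiff ℝ (⊤ : ℕ∞) f ∧ Set.range f ⊆ Set.Icc 0 1 := fun j =>
    (Metric.isOpen_ball.sdiff Metric.isClosed_closedBall).exists_contDiff_support_eq
  choose f hsupp hsmooth hrange using hex
  have hf0 : ∀ j x, 0 ≤ f j x := fun j x => (hrange j ⟨x, rfl⟩).1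
  have hf1 : ∀ j x, f j x ≤ 1 := fun j x => (hrange j ⟨x, rfl⟩).2
  have hzero : ∀ (j : ℕ) (x : E), ‖x‖ ≤ 1 / ((j : ℝ) + 1) → f j x = 0 := by
    intro j x hx
    by_contra hne
    have hmem : x ∈ Function.support (f j) := hne
    rw [hsupp] at hmem
    exact hmem.2 (mem_closedBall_zero_iff.2 hx)
  have hcpt : ∀ j, HasCompactSupport (f j) := fun j =>
    HasCompactSupport.of_support_subset_isCompact (isCompact_closedBall (0 : E) R)
      ((hsupp j).subset.trans (sdiff_subset.trans Metric.ball_subset_closedBall))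
  choose M hM1 hM using fun j =>
    exists_bound_iteratedFDeriv_of_hasCompactSupport (hsmooth j) (hcpt j) j
  have hMpos : ∀ j, 0 < M j := fun j => one_pos.trans_le (hM1 j)
  set p : ℕ → ℝ := fun j => (1 / 2) ^ (j + 1) with hp
  have hppos : ∀ j, 0 < p j := fun j => by positivity
  have hpsum : HasSum p 1 := by
    simpa [hp, pow_succ] using hasSum_geometric_two.mul_right (1 / 2 : ℝ)
  set c : ℕ → ℝ := fun j => b j * p j / M j with hc
  have hcpos : ∀ j, 0 < c j := fun j => div_pos (mul_pos (hpos j) (hppos j)) (hMpos j)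
  have hcle : ∀ j, c j ≤ b j * p j := fun j =>
    div_le_self (mul_pos (hpos j) (hppos j)).le (hM1 j)
  have hterm0 : ∀ j x, 0 ≤ c j * f j x := fun j x => mul_nonneg (hcpos j).le (hf0 j x)
  have hterm : ∀ j x, c j * f j x ≤ b j * p j := fun j x =>
    (mul_le_of_le_one_right (hcpos j).le (hf1 j x)).trans (hcle j)
  have hterm' : ∀ j x, c j * f j x ≤ b 0 * p j := fun j x =>
    (hterm j x).trans (mul_le_mul_of_nonneg_right (hanti j.zero_le) (hppos j).le)
  have hsum : ∀ x, Summable fun j => c j * f j x := fun x =>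
    Summable.of_nonneg_of_le (hterm0 · x) (hterm' · x) (hpsum.summable.mul_left _)
  have hbound : ∀ (x : E) (B : ℝ), (∀ j, c j * f j x ≤ B * p j) →
      ∑' j, c j * f j x ≤ B := by
    intro x B h
    simpa using hasSum_le h (hsum x).hasSum (hpsum.mul_left B)
  refine ⟨fun x => ∑' j, c j * f j x, ?_, fun x => tsum_nonneg (hterm0 · x),
    fun x => hbound x _ (hterm' · x), ?_, ?_, ?_⟩
  · refine contDiff_tsum_of_eventually (v := fun _ j => b 0 * p j)
      (fun j => contDiff_const.mul (hsmooth j))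
      (fun _ _ => hpsum.summable.mul_left _) fun k _ => ?_
    rw [Nat.cofinite_eq_atTop]
    filter_upwards [eventually_ge_atTop k] with j hj x
    have hd : iteratedFDeriv ℝ k (fun y => c j * f j y) x = c j • iteratedFDeriv ℝ k (f j) x :=
      iteratedFDeriv_const_smul_apply' (a := c j)
        ((hsmooth j).contDiffAt.of_le (by exact_mod_cast le_top))
    rw [hd, norm_smul, Real.norm_of_nonneg (hcpos j).le]
    calc c j * ‖iteratedFDeriv ℝ k (f j) x‖ ≤ c j * M j :=
          mul_le_mul_of_nonneg_left (hM j k hj x) (hcpos j).le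
      _ = b j * p j := div_mul_cancel₀ _ (hMpos j).ne'
      _ ≤ b 0 * p j := mul_le_mul_of_nonneg_right (hanti j.zero_le) (hppos j).le
  · have h : ∀ j, f j 0 = 0 := fun j => hzero j 0 (by rw [norm_zero]; positivity)
    simp [h]
  · intro x hx hxR
    obtain ⟨j, hj⟩ := exists_nat_one_div_lt (norm_pos_iff.2 hx)
    have hmem : x ∈ Function.support (f j) := by
      rw [hsupp]
      exact ⟨mem_ball_zero_iff.2 hxR, fun h => hj.not_ge (mem_closedBall_zero_iff.1 h)⟩
    exact (hsum x).tsum_pos (hterm0 · x) j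
      (mul_pos (hcpos j) ((hf0 j x).lt_of_ne' hmem))
  · intro i x hx
    refine hbound x _ fun j => ?_
    rcases le_total i j with hij | hij
    · exact (hterm j x).trans (mul_le_mul_of_nonneg_right (hanti hij) (hppos j).le)
    · rw [hzero j x (hx.trans (Nat.one_div_le_one_div hij)), mul_zero]
      exact (mul_pos (hpos i) (hppos j)).le

/-- **Lemma 3.6.** Given a strictly decreasing sequence of positive numbers
`1 = β₀ > β₁ > β₂ > ⋯`, there is a `C^∞` function `w : ℝ^d → [0,1]` vanishing (on the ball of
radius 2) only at `0`, bounded by `β_{i-1}` on the ball of radius `1/(i+1)`, and equal to `1`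
on the annulus `1 ≤ ‖x‖ ≤ 2`. -/
theorem exists_smooth_function_flat_at_zero (d : ℕ) (hd : 1 ≤ d)
    (β : ℕ → ℝ) (hβpos : ∀ i, 0 < β i) (hβdec : StrictAnti β) (hβ0 : β 0 = 1) :
    ∃ w : EuclideanSpace ℝ (Fin d) → ℝ,
      ContDiff ℝ (⊤ : ℕ∞) w ∧
      (∀ x, w x ∈ Set.Icc (0 : ℝ) 1) ∧
      (∀ x : EuclideanSpace ℝ (Fin d), ‖x‖ ≤ 2 → (w x = 0 ↔ x = 0)) ∧
      (∀ i : ℕ, 1 ≤ i → ∀ x : EuclideanSpace ℝ (Fin d),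
        ‖x‖ ≤ 1 / (i + 1) → w x ≤ β (i - 1)) ∧
      (∀ x : EuclideanSpace ℝ (Fin d), 1 ≤ ‖x‖ → ‖x‖ ≤ 2 → w x = 1) := by
  obtain ⟨g, hg, hg0, hgle, hgzero, hgpos, hgβ⟩ :=
    exists_contDiff_pos_on_punctured_ball_le (E := EuclideanSpace ℝ (Fin d)) 3 hβpos
      hβdec.antitone
  rw [hβ0] at hgle
  set χ : EuclideanSpace ℝ (Fin d) → ℝ := fun x => Real.smoothTransition (2 * ‖x‖ ^ 2 - 1)
    with hχ
  have hχsmooth : ContDiff ℝ (⊤ : ℕ∞) χ :=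
    Real.smoothTransition.contDiff.comp
      ((contDiff_const.mul (contDiff_norm_sq ℝ)).sub contDiff_const)
  have hχ0 : ∀ x, 0 ≤ χ x := fun x => Real.smoothTransition.nonneg _
  have hχ1 : ∀ x, χ x ≤ 1 := fun x => Real.smoothTransition.le_one _
  have hχzero : ∀ x, ‖x‖ ≤ 1 / 2 → χ x = 0 := fun x hx =>
    Real.smoothTransition.zero_of_nonpos (by nlinarith [norm_nonneg x])
  have hχone : ∀ x, 1 ≤ ‖x‖ → χ x = 1 := fun x hx =>
    Real.smoothTransition.one_of_one_le (by nlinarith)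
  refine ⟨fun x => (1 - χ x) * g x + χ x,
    ((contDiff_const.sub hχsmooth).mul hg).add hχsmooth, fun x => ⟨?_, ?_⟩,
    fun x hx => ⟨fun h => ?_, ?_⟩, fun i hi x hx => ?_, fun x hx _ => ?_⟩
  · exact add_nonneg (mul_nonneg (sub_nonneg.2 (hχ1 x)) (hg0 x)) (hχ0 x)
  · nlinarith [mul_nonneg (sub_nonneg.2 (hχ1 x)) (sub_nonneg.2 (hgle x))]
  · by_contra hne
    have hgx := hgpos x hne (by linarith)
    have hprod := mul_nonneg (sub_nonneg.2 (hχ1 x)) (hg0 x)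
    have hχx : χ x = 0 := by linarith [hχ0 x]
    simp only [hχx] at h
    linarith
  · rintro rfl
    simp [hgzero, hχzero 0 (by simp)]
  · have hi' : (1 : ℝ) ≤ i := by exact_mod_cast hi
    have hhalf : ‖x‖ ≤ 1 / 2 :=
      hx.trans (one_div_le_one_div_of_le two_pos (by linarith))
    simp only [hχzero x hhalf, sub_zero, one_mul, add_zero]
    exact (hgβ i x hx).trans (hβdec.antitone (Nat.sub_le i 1))
  · simp [hχone x hx]
end

section
/- Let Ψ : ℝ → ℝ be defined by Ψ(t) = e^{−1/t} for t > 0 and Ψ(t) = 0 for t ≤ 0. Let (β_i)_{i ≥ 0} be a nonincreasing sequence of real numbers with 0 < β_i ≤ 1, and set c_i = 1/(i+1) for i ≥ 0. Then the series g(t) = Σ_{i=1}^{∞} 2^{−i−1} β_{i−1} Ψ(t − c_i) converges for every t ∈ ℝ and defines a C^∞ function g : ℝ → ℝ satisfying: (1) g(t) = 0 for all t ≤ 0; (2) g(t) > 0 for all t > 0; (3) for every integer k ≥ 1 and every t with 0 < t < c_k, g(t) ≤ 2^{−k−1} β_k; in particular every derivative of g tends to 0 as t → 0. -/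
open Set Filter Topology

open Polynomial in
/-- Every iterated derivative of `expNegInvGlue` is a polynomial in `x⁻¹` times
`expNegInvGlue x`. -/
theorem expNegInvGlue.exists_iteratedDeriv_eq (n : ℕ) :
    ∃ p : ℝ[X], iteratedDeriv n expNegInvGlue = fun x ↦ p.eval x⁻¹ * expNegInvGlue x := by
  induction n with
  | zero => exact ⟨1, by simp⟩
  | succ n ih =>
    obtain ⟨p, hp⟩ := ih
    refine ⟨X ^ 2 * (p - derivative (R := ℝ) p), ?_⟩
    rw [iteratedDeriv_succ, hp]
    exact funext fun x ↦ (expNegInvGlue.hasDerivAt_polynomial_eval_inv_mul p x).deriv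

theorem expNegInvGlue.le_one (x : ℝ) : expNegInvGlue x ≤ 1 := by
  rcases le_or_gt x 0 with hx | hx
  · simp [expNegInvGlue.zero_of_nonpos hx]
  · have : 0 < x⁻¹ := inv_pos.2 hx
    simp [expNegInvGlue, hx.not_ge, hx.le]

theorem expNegInvGlue.exists_abs_iteratedDeriv_le (n : ℕ) :
    ∃ C : ℝ, ∀ x, |iteratedDeriv n expNegInvGlue x| ≤ C := by
  obtain ⟨p, hp⟩ := expNegInvGlue.exists_iteratedDeriv_eq n
  rw [hp]
  obtain ⟨A, hA⟩ := (isCompact_Icc (a := (0 : ℝ)) (b := 1)).exists_bound_of_continuousOn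
    (expNegInvGlue.continuous_polynomial_eval_inv_mul p).continuousOn
  obtain ⟨B, hB⟩ := (isCompact_Icc (a := (0 : ℝ)) (b := 1)).exists_bound_of_continuousOn
    p.continuous.continuousOn
  refine ⟨max A B, fun x ↦ ?_⟩
  rcases le_total x 1 with h1 | h1
  · rcases le_total x 0 with h0 | h0
    · have := (norm_nonneg _).trans (hA 0 (by simp))
      simpa [expNegInvGlue.zero_of_nonpos h0] using Or.inl this
    · exact le_max_of_le_left (hA x ⟨h0, h1⟩)
  · have hx : |p.eval x⁻¹| ≤ B := hB x⁻¹ ⟨by positivity, inv_le_one_of_one_le₀ h1⟩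
    refine le_max_of_le_right ?_
    rw [abs_mul, abs_of_nonneg (expNegInvGlue.nonneg x)]
    exact (mul_le_of_le_one_right (abs_nonneg _) (expNegInvGlue.le_one x)).trans hx

/-- A weighted series of translates of `expNegInvGlue` with summable weights is smooth. -/
theorem contDiff_tsum_mul_expNegInvGlue_sub {a : ℕ → ℝ} (ha : Summable fun j ↦ |a j|)
    (c : ℕ → ℝ) :
    ContDiff ℝ (⊤ : ℕ∞) fun t ↦ ∑' j, a j * expNegInvGlue (t - c j) := by
  choose C hC using expNegInvGlue.exists_abs_iteratedDeriv_le
  refine contDiff_tsum (v := fun n j ↦ |a j| * C n) (fun j ↦ ?_)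
    (fun n _ ↦ ha.mul_right (C n)) fun n j t _ ↦ ?_
  · exact contDiff_const.mul (expNegInvGlue.contDiff.comp (contDiff_id.sub contDiff_const))
  · rw [norm_iteratedFDeriv_eq_norm_iteratedDeriv, iteratedDeriv_const_mul_field,
      iteratedDeriv_comp_sub_const, norm_mul]
    exact mul_le_mul_of_nonneg_left (hC n _) (abs_nonneg _)

/-- The derivatives of a smooth function vanishing on `(-∞, 0]` tend to `0` at `0`. -/
theorem tendsto_iteratedDeriv_zero_of_eq_zero_of_nonpos {g : ℝ → ℝ}
    (hg : ContDiff ℝ (⊤ : ℕ∞) g) (h0 : ∀ t ≤ 0, g t = 0) (n : ℕ) :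
    Tendsto (iteratedDeriv n g) (𝓝 0) (𝓝 0) := by
  have hc : Continuous (iteratedDeriv n g) :=
    hg.continuous_iteratedDeriv n (mod_cast le_top)
  have hneg : ∀ t < 0, iteratedDeriv n g t = 0 := fun t ht ↦ by
    have : g =ᶠ[𝓝 t] fun _ ↦ 0 := by
      filter_upwards [gt_mem_nhds ht] with s hs using h0 s hs.le
    simpa using (this.iteratedDeriv n).eq_of_nhds
  have hl : Tendsto (iteratedDeriv n g) (𝓝[<] 0) (𝓝 0) :=
    tendsto_const_nhds.congr' (by
      filter_upwards [self_mem_nhdsWithin] with t ht using (hneg t ht).symm)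
  have hz : iteratedDeriv n g 0 = 0 :=
    tendsto_nhds_unique ((hc.tendsto 0).mono_left nhdsWithin_le_nhds) hl
  simpa [hz] using hc.tendsto 0

/-- The series `g(t) = Σ_{i≥1} 2^{-i-1} β_{i-1} Ψ(t - c_i)` (with `Ψ` the standard flat
function `expNegInvGlue` and `c_i = 1/(i+1)`, reindexed by `j = i - 1`) converges everywhere
and defines a `C^∞` function vanishing exactly on `(-∞,0]`, with the bound
`g(t) ≤ 2^{-k-1} β_k` for `0 < t < c_k`; in particular all derivatives of `g` tend to `0`
at `0`. -/
theorem series_of_flat_functions_smooth (β : ℕ → ℝ) (hβanti : Antitone β)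
    (hβ : ∀ i, 0 < β i ∧ β i ≤ 1) :
    ∃ g : ℝ → ℝ,
      (∀ t : ℝ, HasSum
        (fun j : ℕ => (1 / 2 ^ (j + 2) : ℝ) * β j * expNegInvGlue (t - 1 / ((j : ℝ) + 2)))
        (g t)) ∧
      ContDiff ℝ (⊤ : ℕ∞) g ∧
      (∀ t : ℝ, t ≤ 0 → g t = 0) ∧
      (∀ t : ℝ, 0 < t → 0 < g t) ∧
      (∀ k : ℕ, 1 ≤ k → ∀ t : ℝ, 0 < t → t < 1 / ((k : ℝ) + 1) →
        g t ≤ (1 / 2 ^ (k + 1) : ℝ) * β k) ∧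
      (∀ n : ℕ, Filter.Tendsto (iteratedDeriv n g) (nhds 0) (nhds (0 : ℝ))) := by
  have hs : Summable fun j : ℕ ↦ (1 / 2 ^ (j + 2) : ℝ) * β j := by
    refine Summable.of_nonneg_of_le (fun j ↦ mul_nonneg (by positivity) (hβ j).1.le) (fun j ↦ ?_)
      summable_geometric_two
    refine (mul_le_of_le_one_right (by positivity) (hβ j).2).trans ?_
    rw [one_div_pow]
    exact one_div_le_one_div_of_le (by positivity) (pow_le_pow_right₀ (by norm_num) (by omega))
  have hnn : ∀ (t : ℝ) (j : ℕ),
      0 ≤ (1 / 2 ^ (j + 2) : ℝ) * β j * expNegInvGlue (t - 1 / ((j : ℝ) + 2)) := fun t j ↦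
    mul_nonneg (mul_nonneg (by positivity) (hβ j).1.le) (expNegInvGlue.nonneg _)
  have hle : ∀ (t : ℝ) (j : ℕ),
      (1 / 2 ^ (j + 2) : ℝ) * β j * expNegInvGlue (t - 1 / ((j : ℝ) + 2)) ≤
        (1 / 2 ^ (j + 2) : ℝ) * β j := fun t j ↦
    mul_le_of_le_one_right (mul_nonneg (by positivity) (hβ j).1.le) (expNegInvGlue.le_one _)
  have hsum : ∀ t : ℝ, Summable fun j : ℕ ↦
      (1 / 2 ^ (j + 2) : ℝ) * β j * expNegInvGlue (t - 1 / ((j : ℝ) + 2)) := fun t ↦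
    Summable.of_nonneg_of_le (hnn t) (hle t) hs
  have hsmooth := contDiff_tsum_mul_expNegInvGlue_sub hs.abs fun j : ℕ ↦ 1 / ((j : ℝ) + 2)
  have hzero : ∀ t : ℝ, t ≤ 0 →
      ∑' j : ℕ, (1 / 2 ^ (j + 2) : ℝ) * β j * expNegInvGlue (t - 1 / ((j : ℝ) + 2)) = 0 := by
    intro t ht
    have h (j : ℕ) : expNegInvGlue (t - 1 / ((j : ℝ) + 2)) = 0 := by
      have : (0 : ℝ) < 1 / ((j : ℝ) + 2) := by positivity
      exact expNegInvGlue.zero_of_nonpos (by linarith)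
    simp only [h, mul_zero, tsum_zero]
  refine ⟨_, fun t ↦ (hsum t).hasSum, hsmooth, hzero, fun t ht ↦ ?_, fun k _ t _ htk ↦ ?_,
    tendsto_iteratedDeriv_zero_of_eq_zero_of_nonpos hsmooth hzero⟩
  · obtain ⟨j, hj⟩ := exists_nat_one_div_lt ht
    have hlt : 1 / ((j : ℝ) + 2) < t := lt_of_le_of_lt
      (one_div_le_one_div_of_le (by positivity) (by linarith)) hj
    refine (hsum t).tsum_pos (hnn t) j (mul_pos (mul_pos (by positivity) (hβ j).1) ?_)
    exact expNegInvGlue.pos_of_pos (by linarith)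
  · have hvanish : ∀ j ∈ Finset.range k,
        (1 / 2 ^ (j + 2) : ℝ) * β j * expNegInvGlue (t - 1 / ((j : ℝ) + 2)) = 0 := by
      intro j hj
      have hjk : (j : ℝ) + 1 ≤ k := by exact_mod_cast Finset.mem_range.1 hj
      have : 1 / ((k : ℝ) + 1) ≤ 1 / ((j : ℝ) + 2) :=
        one_div_le_one_div_of_le (by positivity) (by linarith)
      rw [expNegInvGlue.zero_of_nonpos (by linarith), mul_zero]
    rw [← (hsum t).sum_add_tsum_nat_add k, Finset.sum_eq_zero hvanish, zero_add]
    refine hasSum_le (fun j ↦ ?_) ((summable_nat_add_iff k).2 (hsum t)).hasSum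
      (hasSum_geometric_two' ((1 / 2 ^ (k + 1) : ℝ) * β k))
    calc _ ≤ (1 / 2 ^ (j + k + 2) : ℝ) * β (j + k) := hle t (j + k)
      _ ≤ (1 / 2 ^ (j + k + 2) : ℝ) * β k :=
        mul_le_mul_of_nonneg_left (hβanti (by omega)) (by positivity)
      _ = _ := by
        field_simp
        ring
end

section
/- Let (M,d) be a compact metric space and f : M → M a minimal homeomorphism, i.e. a homeomorphism such that for every x ∈ M the forward orbit {fⁿ(x) : n ≥ 0} is dense in M. Then for every ε > 0 there exists a constant c > 0 such that for every f-invariant ergodic Borel probability measure μ and every x ∈ M, μ(B(x,ε)) ≥ c, where B(x,ε) is the open ball of radius ε around x. -/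
open Set Filter Topology MeasureTheory

/-- If every forward orbit of a continuous self-map of a compact space is dense, then finitely
many iterated preimages of a nonempty open set cover the space. -/
theorem exists_finset_iUnion_preimage_iterate_eq_univ {X : Type*} [TopologicalSpace X]
    [CompactSpace X] {f : X → X} (hf : Continuous f)
    (hdense : ∀ x : X, Dense {y : X | ∃ n : ℕ, f^[n] x = y})
    {U : Set X} (hU : IsOpen U) (hne : U.Nonempty) :
    ∃ t : Finset ℕ, ⋃ n ∈ t, f^[n] ⁻¹' U = univ := by
  obtain ⟨t, ht⟩ := isCompact_univ.elim_finite_subcover (fun n : ℕ => f^[n] ⁻¹' U)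
    (fun n => hU.preimage (hf.iterate n)) (fun x _ => by
      obtain ⟨y, hyU, n, rfl⟩ := (hdense x).inter_open_nonempty U hU hne
      exact mem_iUnion.2 ⟨n, hyU⟩)
  exact ⟨t, univ_subset_iff.1 ht⟩

/-- If `k` iterated preimages of `U` cover the space, an invariant probability measure satisfies
`1 ≤ k * μ U`. -/
theorem one_le_card_mul_measure_of_iUnion_preimage_iterate_eq_univ {X : Type*}
    [MeasurableSpace X] {f : X → X} {μ : Measure X} [IsProbabilityMeasure μ]
    (hμ : MeasurePreserving f μ μ) {U : Set X} (hU : MeasurableSet U) {t : Finset ℕ}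
    (ht : ⋃ n ∈ t, f^[n] ⁻¹' U = univ) :
    1 ≤ (t.card : ENNReal) * μ U := by
  calc (1 : ENNReal) = μ (⋃ n ∈ t, f^[n] ⁻¹' U) := by rw [ht, measure_univ]
    _ ≤ ∑ n ∈ t, μ (f^[n] ⁻¹' U) := measure_biUnion_finset_le _ _
    _ = (t.card : ENNReal) * μ U := by
      simp [(hμ.iterate _).measure_preimage hU.nullMeasurableSet]

/-- **Lemma (uniform mass of balls).** For a minimal homeomorphism `f` of a compact metric
space and any `ε > 0`, there is a constant `c > 0` such that every `f`-invariant ergodic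
Borel probability measure gives mass at least `c` to every open `ε`-ball. -/
theorem minimal_homeomorphism_uniform_ball_mass
    (M : Type*) [MetricSpace M] [CompactSpace M] [MeasurableSpace M] [BorelSpace M]
    (f : M → M) (hf : IsHomeomorph f)
    (hmin : ∀ x : M, Dense {y : M | ∃ n : ℕ, f^[n] x = y}) :
    ∀ ε : ℝ, 0 < ε → ∃ c : ENNReal, 0 < c ∧
      ∀ μ : Measure M, IsProbabilityMeasure μ →
        (∀ A : Set M, MeasurableSet A → μ (f ⁻¹' A) = μ A) →
        (∀ A : Set M, MeasurableSet A → f ⁻¹' A = A → μ A = 0 ∨ μ A = 1) →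
        ∀ x : M, c ≤ μ (Metric.ball x ε) := by
  intro ε hε
  have hε2 : 0 < ε / 2 := half_pos hε
  have hcover (y : M) : ∃ t : Finset ℕ, ⋃ n ∈ t, f^[n] ⁻¹' Metric.ball y (ε / 2) = univ :=
    exists_finset_iUnion_preimage_iterate_eq_univ hf.continuous hmin Metric.isOpen_ball
      ⟨y, Metric.mem_ball_self hε2⟩
  choose t ht using hcover
  obtain ⟨s, hs⟩ := isCompact_univ.elim_finite_subcover (fun y : M => Metric.ball y (ε / 2))
    (fun y => Metric.isOpen_ball) (fun x _ => mem_iUnion.2 ⟨x, Metric.mem_ball_self hε2⟩)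
  refine ⟨((∑ y ∈ s, (t y).card : ℕ) : ENNReal)⁻¹,
    ENNReal.inv_pos.2 (ENNReal.natCast_ne_top _), ?_⟩
  intro μ _ hinv _ x
  have hμ : MeasurePreserving f μ μ :=
    ⟨hf.continuous.measurable, Measure.ext fun A hA => by
      rw [Measure.map_apply hf.continuous.measurable hA, hinv A hA]⟩
  obtain ⟨y, hys, hxy⟩ := mem_iUnion₂.1 (hs (mem_univ x))
  have hsub : Metric.ball y (ε / 2) ⊆ Metric.ball x ε :=
    Metric.ball_subset_ball' (by linarith [Metric.mem_ball'.1 hxy])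
  have hcard : (t y).card ≤ ∑ z ∈ s, (t z).card :=
    Finset.single_le_sum (f := fun z => (t z).card) (fun _ _ => Nat.zero_le _) hys
  rw [ENNReal.inv_le_iff_le_mul (fun h => absurd h (measure_ne_top _ _))
    (fun h => absurd h (ENNReal.natCast_ne_top _))]
  calc (1 : ENNReal) ≤ ((t y).card : ENNReal) * μ (Metric.ball y (ε / 2)) :=
        one_le_card_mul_measure_of_iUnion_preimage_iterate_eq_univ hμ measurableSet_ball (ht y)
    _ ≤ _ := by gcongr
end
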